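/- Let B be a finite-dimensional semisimple Q-algebra. Given a bound on dim_Q(B) and a bound on the absolute value of the discriminant of orders contained in B, there are only finitely many isomorphism classes of pairs (B, Λ) where Λ is an order in B with |discr(Λ)| below the given bound. -/

import Mathlib

open scoped TensorProduct

noncomputable def gramDet (R : Type) (S : Type) {M : Type} [CommRing R] [AddCommGroup M]
    [Module R M] [Module.Free R M] [Module.Finite R M] [CommRing S] (B : M → M → S) : S :=
  letI := Classical.decEq (Module.Free.ChooseBasisIndex R M)
  Matrix.det (Matrix.of fun i j => B (Module.Free.chooseBasis R M i) (Module.Free.chooseBasis R M j))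

/-- `t : B → K` is the (relative) reduced trace of the finite-dimensional separable
semisimple `K`-algebra `B`: after base change to an algebraic closure, `B` becomes a finite
product of matrix algebras and `t` is computed by the sum of the matrix traces. -/
def IsReducedTrace (K : Type) [Field K] (B : Type) [Ring B] [Algebra K B]
    (t : B →ₗ[K] K) : Prop :=
  ∃ (m : ℕ) (n : Fin m → ℕ)
    (e : (AlgebraicClosure K ⊗[K] B) ≃ₐ[AlgebraicClosure K]
      ((i : Fin m) → Matrix (Fin (n i)) (Fin (n i)) (AlgebraicClosure K))),
    ∀ x : B, algebraMap K (AlgebraicClosure K) (t x)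
      = ∑ i, Matrix.trace (e ((1 : AlgebraicClosure K) ⊗ₜ[K] x) i)

/-- The trace of left multiplication on an algebra, as a linear functional. -/
noncomputable def regTrace (K A : Type) [CommRing K] [Ring A] [Algebra K A] : A →ₗ[K] K :=
  LinearMap.trace K A ∘ₗ LinearMap.mul K A

lemma regTrace_eq_sum_repr {K A ι : Type} [CommRing K] [Ring A] [Algebra K A] [Fintype ι]
    (b : Module.Basis ι K A) (x : A) : regTrace K A x = ∑ i, b.repr (x * b i) i := by
  classical
  rw [regTrace, LinearMap.comp_apply, LinearMap.trace_eq_matrix_trace K b]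
  simp [Matrix.trace, LinearMap.toMatrix_apply]

lemma regTrace_mul_comm {K A : Type} [CommRing K] [Ring A] [Algebra K A] (x y : A) :
    regTrace K A (x * y) = regTrace K A (y * x) := by
  have h : ∀ x y : A, LinearMap.mul K A (x * y) = LinearMap.mul K A x * LinearMap.mul K A y :=
    fun x y => LinearMap.ext fun z => by simp [mul_assoc]
  rw [regTrace, LinearMap.comp_apply, LinearMap.comp_apply, h, h, LinearMap.trace_mul_comm]

lemma regTrace_algEquiv {K A A' : Type} [CommRing K] [Ring A] [Algebra K A] [Ring A']
    [Algebra K A'] (e : A ≃ₐ[K] A') (x : A) : regTrace K A' (e x) = regTrace K A x := by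
  rw [regTrace, regTrace, LinearMap.comp_apply, LinearMap.comp_apply,
    ← LinearMap.trace_conj' (LinearMap.mul K A x) e.toLinearEquiv]
  congr 1
  ext y
  simp [LinearEquiv.conj_apply]

section MatrixProduct

variable {K : Type} [Field K] {r : ℕ} {n : Fin r → ℕ} {D : Fin r → Type}
  [∀ k, Ring (D k)] [∀ k, Algebra K (D k)] {ι : Fin r → Type} [∀ k, Fintype (ι k)]

/-- The standard basis of a product of matrix algebras attached to bases of the coefficient
algebras. -/
noncomputable def matBasis (n : Fin r → ℕ) (u : ∀ k, Module.Basis (ι k) K (D k)) :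
    Module.Basis (Σ k, Fin (n k) × Fin (n k) × ι k) K
      (∀ k, Matrix (Fin (n k)) (Fin (n k)) (D k)) :=
  Pi.basis fun k => (u k).matrix (Fin (n k)) (Fin (n k))

omit [∀ k, Fintype (ι k)] in
lemma matBasis_apply (u : ∀ k, Module.Basis (ι k) K (D k)) (k : Fin r) (i j : Fin (n k))
    (l : ι k) : matBasis n u ⟨k, i, j, l⟩ = Pi.single k (Matrix.single i j (u k l)) := by
  simp [matBasis, Pi.basis_apply]

omit [∀ k, Fintype (ι k)] in
lemma matBasis_repr (u : ∀ k, Module.Basis (ι k) K (D k))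
    (x : ∀ k, Matrix (Fin (n k)) (Fin (n k)) (D k)) (k : Fin r) (i j : Fin (n k)) (l : ι k) :
    (matBasis n u).repr x ⟨k, i, j, l⟩ = (u k).repr (x k i j) l := by
  simp only [matBasis, Pi.basis_repr]
  suffices h : ∀ y : Matrix (Fin (n k)) (Fin (n k)) (D k),
      ((u k).matrix (Fin (n k)) (Fin (n k))).repr y (i, j, l) = (u k).repr (y i j) l from h _
  intro y
  have h2 : (Finsupp.lapply (i, j, l) : _ →ₗ[K] K) ∘ₗ
      ((u k).matrix (Fin (n k)) (Fin (n k))).repr.toLinearMap =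
      (u k).coord l ∘ₗ Matrix.entryLinearMap K (D k) i j := by
    refine ((u k).matrix (Fin (n k)) (Fin (n k))).ext fun a => ?_
    obtain ⟨i', j', l'⟩ := a
    classical
    simp only [LinearMap.comp_apply, LinearEquiv.coe_coe, Module.Basis.repr_self]
    simp only [Finsupp.lapply_apply, Module.Basis.coord_apply, Matrix.entryLinearMap_apply,
      Module.Basis.matrix_apply, Matrix.single_apply, Finsupp.single_apply, Prod.mk.injEq]
    by_cases h1 : i' = i <;> by_cases h2 : j' = j <;> simp [h1, h2, Finsupp.single_apply]
  exact LinearMap.congr_fun h2 y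

omit [∀ k, Fintype (ι k)] in
lemma matBasis_repr_mul (u : ∀ k, Module.Basis (ι k) K (D k))
    (x : ∀ k, Matrix (Fin (n k)) (Fin (n k)) (D k))
    (k : Fin r) (i j : Fin (n k)) (l : ι k) (k' : Fin r) (i' j' : Fin (n k')) (l' : ι k') :
    (matBasis n u).repr (x * matBasis n u ⟨k, i, j, l⟩) ⟨k', i', j', l'⟩ =
      if h : k' = k then
        if j = h ▸ j' then (u k).repr (x k (h ▸ i') i * u k l) (h ▸ l') else 0
      else 0 := by
  rw [matBasis_apply, matBasis_repr, Pi.mul_apply]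
  by_cases h : k' = k
  · subst h
    simp only [Pi.single_eq_same, dite_true]
    by_cases hj : j = j'
    · subst hj
      simp
    · simp [hj, Matrix.mul_single_apply_of_ne, Ne.symm hj]
  · simp [h]

lemma regTrace_pi_matrix (u : ∀ k, Module.Basis (ι k) K (D k))
    (x : ∀ k, Matrix (Fin (n k)) (Fin (n k)) (D k)) :
    regTrace K (∀ k, Matrix (Fin (n k)) (Fin (n k)) (D k)) x = ∑ k, (n k : K) * ∑ i, regTrace K (D k) (x k i i) := by
  rw [regTrace_eq_sum_repr (matBasis n u), Fintype.sum_sigma]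
  refine Finset.sum_congr rfl fun k _ => ?_
  simp only [Fintype.sum_prod_type, matBasis_repr_mul, dite_true, if_true]
  simp only [regTrace_eq_sum_repr (u k), Finset.sum_const, Finset.card_univ, Fintype.card_fin,
    Finset.mul_sum, nsmul_eq_mul]

omit [∀ k, Fintype (ι k)] in
lemma abs_matBasis_repr_le [LinearOrder K] [IsStrictOrderedRing K]
    (u : ∀ k, Module.Basis (ι k) K (D k)) {C : K} (hC : 0 ≤ C)
    (hu : ∀ k i j l, |(u k).repr (u k i * u k j) l| ≤ C) (a b c) :
    |(matBasis n u).repr (matBasis n u a * matBasis n u b) c| ≤ C := by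
  obtain ⟨k, i, j, l⟩ := b
  obtain ⟨k', i', j', l'⟩ := c
  obtain ⟨k₁, i₁, j₁, l₁⟩ := a
  rw [matBasis_repr_mul]
  split_ifs with h h'
  · subst h
    rw [matBasis_apply]
    by_cases h1 : k₁ = k'
    · subst h1
      simp only [Pi.single_eq_same, Matrix.single_apply]
      split_ifs
      · exact hu _ _ _ _
      · simpa using hC
    · simpa [Ne.symm h1] using hC
  · simpa using hC
  · simpa using hC

end MatrixProduct

lemma Matrix.trace_eq_zero_of_sq_eq_neg {ι : Type} [Fintype ι] [DecidableEq ι]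
    (M : Matrix ι ι ℝ) {s : ℝ} (hs : 0 < s) (hM : M * M = -(s • 1)) : M.trace = 0 := by
  set A : Matrix ι ι ℂ := M.map (algebraMap ℝ ℂ) with hA
  have hAA : A * A = -((s : ℂ) • 1) := by
    have := congrArg (fun X : Matrix ι ι ℝ => X.map (algebraMap ℝ ℂ)) hM
    simp only [Matrix.map_mul] at this
    rw [hA, this]
    ext i j
    by_cases h : i = j <;> simp [h]
  have hroots : ∀ z ∈ A.charpoly.roots, z.re = 0 := by
    intro z hz
    have hz' : A.charpoly.IsRoot z := (Polynomial.mem_roots'.1 hz).2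
    have hev : Module.End.HasEigenvalue (Matrix.toLin' A) z := by
      rw [Module.End.hasEigenvalue_iff_isRoot_charpoly]
      simpa using hz'
    obtain ⟨v, hv⟩ := hev.exists_hasEigenvector
    have h1 : A.mulVec v = z • v := by simpa using hv.apply_eq_smul
    have h2 : (A * A).mulVec v = (z * z) • v := by
      rw [← Matrix.mulVec_mulVec, h1, Matrix.mulVec_smul, h1, smul_smul]
    rw [hAA, Matrix.neg_mulVec, Matrix.smul_mulVec, Matrix.one_mulVec, ← neg_smul] at h2
    have h3 : -(s : ℂ) = z * z := smul_left_injective ℂ hv.2 h2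
    have hre := congrArg Complex.re h3
    have him := congrArg Complex.im h3
    simp at hre him
    by_contra hne
    have : z.im = 0 := by
      have : z.re * z.im = 0 := by linarith
      exact (mul_eq_zero.1 this).resolve_left hne
    rw [this] at hre
    nlinarith [mul_self_nonneg z.re]
  have htr : A.trace = (M.trace : ℂ) := by
    simp [hA, Matrix.trace]
  have hsum : A.trace = A.charpoly.roots.sum := Matrix.trace_eq_sum_roots_charpoly A
  have : (A.charpoly.roots.sum).re = 0 := by
    have h4 : (A.charpoly.roots.sum).re = (A.charpoly.roots.map Complex.re).sum :=
      map_multiset_sum Complex.reAddGroupHom _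
    rw [h4]
    exact Multiset.sum_eq_zero (by
      intro x hx
      obtain ⟨z, hz, rfl⟩ := Multiset.mem_map.1 hx
      exact hroots z hz)
  rw [← hsum, htr] at this
  simpa using this

section RealDivision

variable {D : Type} [DivisionRing D] [Algebra ℝ D] [FiniteDimensional ℝ D]

lemma regTrace_algebraMap {K A : Type} [Field K] [Ring A] [Algebra K A] [FiniteDimensional K A]
    (c : K) : regTrace K A (algebraMap K A c) = Module.finrank K A * c := by
  rw [regTrace_eq_sum_repr (Module.finBasis K A)]
  simp [← Algebra.smul_def]

lemma regTrace_eq_zero_of_sq_eq_neg {w : D} {s : ℝ} (hs : 0 < s)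
    (hw : w * w = algebraMap ℝ D (-s)) : regTrace ℝ D w = 0 := by
  have b := Module.finBasis ℝ D
  rw [regTrace, LinearMap.comp_apply, LinearMap.trace_eq_matrix_trace ℝ b]
  refine Matrix.trace_eq_zero_of_sq_eq_neg _ hs ?_
  rw [← LinearMap.toMatrix_mul, show LinearMap.mul ℝ D w * LinearMap.mul ℝ D w
    = -(s • 1) from ?_]
  · simp
  · ext z
    simp [← mul_assoc, hw, Algebra.smul_def]

lemma exists_quadratic (y : D) : ∃ b c : ℝ, y * y + b • y + algebraMap ℝ D c = 0 := by
  have hint : IsIntegral ℝ y := Algebra.IsIntegral.isIntegral y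
  have hirr := minpoly.irreducible hint
  have hdeg := hirr.degree_le_two
  have hmon := minpoly.monic hint
  have hnd : (minpoly ℝ y).natDegree ≤ 2 := Polynomial.natDegree_le_of_degree_le hdeg
  have haev := minpoly.aeval ℝ y
  have hpos : 0 < (minpoly ℝ y).natDegree := minpoly.natDegree_pos hint
  obtain h | h : (minpoly ℝ y).natDegree = 1 ∨ (minpoly ℝ y).natDegree = 2 := by omega
  · rw [Polynomial.aeval_eq_sum_range, h] at haev
    have hc : (minpoly ℝ y).coeff 1 = 1 := h ▸ hmon.coeff_natDegree
    simp [Finset.sum_range_succ, hc] at haev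
    refine ⟨(minpoly ℝ y).coeff 0, 0, ?_⟩
    have := congrArg (· * y) haev
    simp [add_mul] at this
    rw [← this]; simp [add_comm]
  · rw [Polynomial.aeval_eq_sum_range, h] at haev
    have hc : (minpoly ℝ y).coeff 2 = 1 := h ▸ hmon.coeff_natDegree
    simp [Finset.sum_range_succ, hc] at haev
    refine ⟨(minpoly ℝ y).coeff 1, (minpoly ℝ y).coeff 0, ?_⟩
    rw [← haev, Algebra.algebraMap_eq_smul_one, sq]
    abel

lemma sq_of_regTrace_eq_zero {y : D} (hy : regTrace ℝ D y = 0) :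
    ∃ s : ℝ, 0 ≤ s ∧ y * y = algebraMap ℝ D (-s) := by
  have hd : (Module.finrank ℝ D : ℝ) ≠ 0 := by exact_mod_cast Module.finrank_pos.ne'
  have hscalar : ∀ c : ℝ, y = algebraMap ℝ D c → ∃ s : ℝ, 0 ≤ s ∧ y * y = algebraMap ℝ D (-s) := by
    intro c hc
    rw [hc, regTrace_algebraMap] at hy
    have : c = 0 := (mul_eq_zero.1 hy).resolve_left hd
    exact ⟨0, le_rfl, by simp [hc, this]⟩
  obtain ⟨b, c, h⟩ := exists_quadratic y
  set w := y + algebraMap ℝ D (b / 2) with hw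
  have hcomm : ∀ t : ℝ, algebraMap ℝ D t * y = y * algebraMap ℝ D t := fun t =>
    Algebra.commutes t y
  have hww : w * w = algebraMap ℝ D (b ^ 2 / 4 - c) := by
    have e1 : w * w = (y * y + b • y + algebraMap ℝ D c) + algebraMap ℝ D (b ^ 2 / 4 - c) := by
      rw [hw, Algebra.smul_def, add_mul, mul_add, mul_add, hcomm, ← map_mul,
        show algebraMap ℝ D b = algebraMap ℝ D (b/2) + algebraMap ℝ D (b/2) by
          rw [← map_add]; congr 1; ring, add_mul, hcomm,
        show b ^ 2 / 4 - c = b/2 * (b/2) - c by ring, map_sub]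
      abel
    rw [e1, h, zero_add]
  by_cases hneg : b ^ 2 / 4 - c < 0
  · have hw0 : regTrace ℝ D w = 0 := regTrace_eq_zero_of_sq_eq_neg (s := -(b ^ 2 / 4 - c))
      (by linarith) (by rw [hww]; congr 1; ring)
    rw [hw, map_add, hy, zero_add, regTrace_algebraMap] at hw0
    have hb : b / 2 = 0 := (mul_eq_zero.1 hw0).resolve_left hd
    have hyw : w = y := by rw [hw, hb]; simp
    exact ⟨-(b ^ 2 / 4 - c), by linarith, by rw [← hyw, hww]; congr 1; ring⟩
  · push Not at hneg
    set r := Real.sqrt (b ^ 2 / 4 - c) with hr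
    have hr2 : r * r = b ^ 2 / 4 - c := Real.mul_self_sqrt hneg
    have hfac : (w - algebraMap ℝ D r) * (w + algebraMap ℝ D r) = 0 := by
      rw [sub_mul, mul_add w w, mul_add _ w, hww, ← map_mul, hr2, Algebra.commutes r w]
      abel
    rcases mul_eq_zero.1 hfac with h0 | h0
    · refine hscalar (r - b / 2) ?_
      rw [map_sub, ← sub_eq_zero.1 h0, hw]; abel
    · refine hscalar (-r - b / 2) ?_
      rw [map_sub, map_neg, ← eq_neg_of_add_eq_zero_left h0, hw]; abel


/-- The normalised trace form twisted by the canonical involution of a real division algebra. -/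
noncomputable def divForm (D : Type) [DivisionRing D] [Algebra ℝ D] (x y : D) : ℝ :=
  2 * (regTrace ℝ D x / Module.finrank ℝ D) * (regTrace ℝ D y / Module.finrank ℝ D) -
    regTrace ℝ D (x * y) / Module.finrank ℝ D

omit [FiniteDimensional ℝ D] in
lemma divForm_add_left (x y z : D) : divForm D (x + y) z = divForm D x z + divForm D y z := by
  simp only [divForm, add_mul, map_add]; ring

omit [FiniteDimensional ℝ D] in
lemma divForm_smul_left (c : ℝ) (x y : D) : divForm D (c • x) y = c * divForm D x y := by
  simp only [divForm, smul_mul_assoc, map_smul, smul_eq_mul]; ring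

omit [FiniteDimensional ℝ D] in
lemma divForm_comm (x y : D) : divForm D x y = divForm D y x := by
  simp only [divForm, regTrace_mul_comm x y]; ring

omit [FiniteDimensional ℝ D] in
lemma divForm_add_right (x y z : D) : divForm D x (y + z) = divForm D x y + divForm D x z := by
  simp only [divForm, mul_add, map_add]; ring

lemma regTrace_one_div : regTrace ℝ D 1 / Module.finrank ℝ D = 1 := by
  have hd : (Module.finrank ℝ D : ℝ) ≠ 0 := by exact_mod_cast Module.finrank_pos.ne'
  have h1 : regTrace ℝ D 1 = Module.finrank ℝ D := by
    simpa using regTrace_algebraMap (K := ℝ) (A := D) 1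
  rw [h1, div_self hd]

lemma exists_mul_self_eq (x : D) : ∃ s : ℝ, 0 ≤ s ∧
    divForm D x x = (regTrace ℝ D x / Module.finrank ℝ D) ^ 2 + s ∧
    (x - (regTrace ℝ D x / Module.finrank ℝ D) • 1) *
      (x - (regTrace ℝ D x / Module.finrank ℝ D) • 1) = (-s) • 1 := by
  have hd : (Module.finrank ℝ D : ℝ) ≠ 0 := by exact_mod_cast Module.finrank_pos.ne'
  set a := regTrace ℝ D x / Module.finrank ℝ D with ha
  have h1 : regTrace ℝ D (1 : D) = Module.finrank ℝ D := by
    simpa using regTrace_algebraMap (K := ℝ) (A := D) 1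
  have hax : regTrace ℝ D x = a * Module.finrank ℝ D := by rw [ha]; field_simp
  obtain ⟨s, hs, h⟩ := sq_of_regTrace_eq_zero (y := x - a • (1 : D)) (by
    rw [map_sub, map_smul, h1, hax]; simp)
  rw [Algebra.algebraMap_eq_smul_one] at h
  refine ⟨s, hs, ?_, h⟩
  have hxx : x * x = (2 * a) • x + (-s - a ^ 2) • (1 : D) := by
    have : x * x = (x - a • (1 : D)) * (x - a • (1 : D)) + (2 * a) • x - (a ^ 2) • (1 : D) := by
      simp only [sub_mul, mul_sub, smul_mul_assoc, mul_smul_comm, one_mul, mul_one]; module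
    rw [this, h]; module
  rw [divForm, hxx, ← ha, map_add, map_smul, map_smul, h1, hax]
  simp only [smul_eq_mul]
  field_simp
  ring

lemma mul_self_eq_divForm (x : D) :
    x * x = (2 * (regTrace ℝ D x / Module.finrank ℝ D)) • x - divForm D x x • (1 : D) := by
  obtain ⟨s, -, h1, h2⟩ := exists_mul_self_eq x
  set a := regTrace ℝ D x / Module.finrank ℝ D
  have : x * x = (x - a • (1 : D)) * (x - a • (1 : D)) + (2 * a) • x - (a ^ 2) • (1 : D) := by
    simp only [sub_mul, mul_sub, smul_mul_assoc, mul_smul_comm, one_mul, mul_one]; module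
  rw [this, h2, h1]; module

lemma divForm_self_nonneg (x : D) : 0 ≤ divForm D x x := by
  obtain ⟨s, h0, h1, -⟩ := exists_mul_self_eq x
  rw [h1]; positivity

lemma eq_zero_of_divForm_self_eq_zero (x : D) (hx : divForm D x x = 0) : x = 0 := by
  obtain ⟨s, h0, h1, h2⟩ := exists_mul_self_eq x
  set a := regTrace ℝ D x / Module.finrank ℝ D
  have hs : s = 0 := by nlinarith [sq_nonneg a]
  have ha : a = 0 := by
    have : a ^ 2 = 0 := by nlinarith [sq_nonneg a]
    exact pow_eq_zero_iff two_ne_zero |>.1 this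
  rw [hs, ha] at h2
  simpa using h2

lemma divForm_mul_self (x y : D) :
    divForm D (x * y) (x * y) = divForm D x x * divForm D y y := by
  have hx := mul_self_eq_divForm x
  have hy := mul_self_eq_divForm y
  have hxy := mul_self_eq_divForm (x * y)
  have hp := mul_self_eq_divForm (x + y)
  have hf : divForm D x y = 2 * (regTrace ℝ D x / Module.finrank ℝ D) *
    (regTrace ℝ D y / Module.finrank ℝ D) - regTrace ℝ D (x * y) / Module.finrank ℝ D := rfl
  rw [map_add, add_div, divForm_add_left, divForm_add_right, divForm_add_right,
    divForm_comm y x] at hp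
  set a := regTrace ℝ D x / Module.finrank ℝ D
  set b := regTrace ℝ D y / Module.finrank ℝ D
  set c := regTrace ℝ D (x * y) / Module.finrank ℝ D
  set f := divForm D x y
  set p := divForm D x x
  set q := divForm D y y
  have hyx : y * x = -(x * y) + (2 * a) • y + (2 * b) • x - (2 * f) • (1 : D) := by
    have e : y * x = (x + y) * (x + y) - x * x - y * y - x * y := by noncomm_ring
    rw [e, hp, hx, hy]; module
  have h1 : x * y * (x * y) = (2 * c) • (x * y) - (p * q) • (1 : D) := by
    calc x * y * (x * y) = x * (y * x) * y := by noncomm_ring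
      _ = -((x * x) * (y * y)) + (2 * a) • (x * (y * y)) + (2 * b) • ((x * x) * y)
          - (2 * f) • (x * y) := by
        rw [hyx]
        simp only [mul_add, mul_sub, add_mul, sub_mul, mul_neg, neg_mul, mul_smul_comm,
          smul_mul_assoc, mul_one, mul_assoc]
      _ = _ := by
        rw [hx, hy, hf]
        simp only [mul_sub, sub_mul, mul_smul_comm, smul_mul_assoc, mul_one, one_mul]
        module
  rw [h1] at hxy
  have h2 : (p * q) • (1 : D) = (divForm D (x * y) (x * y)) • (1 : D) := sub_right_injective hxy
  exact (smul_left_injective ℝ (one_ne_zero : (1 : D) ≠ 0) h2).symm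

/-- A finite-dimensional real division algebra has a basis with structure constants bounded by `1`
that is orthogonal for the regular trace form. -/
lemma exists_basis_real_divisionRing (D : Type) [DivisionRing D] [Algebra ℝ D]
    [FiniteDimensional ℝ D] : ∃ (ι : Type) (_ : Fintype ι) (u : Module.Basis ι ℝ D),
      (∀ i j k, |u.repr (u i * u j) k| ≤ 1) ∧
      (∀ i j, i ≠ j → regTrace ℝ D (u i * u j) = 0) ∧
      ∀ i, 1 ≤ |regTrace ℝ D (u i * u i)| := by
  classical
  have hd : (1 : ℝ) ≤ Module.finrank ℝ D := by exact_mod_cast Module.finrank_pos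
  let core : InnerProductSpace.Core ℝ D :=
    { inner := divForm D
      conj_inner_symm := fun x y => by simpa using divForm_comm y x
      re_inner_nonneg := fun x => by simpa using divForm_self_nonneg x
      add_left := divForm_add_left
      smul_left := fun x y c => by simpa using divForm_smul_left c x y
      definite := eq_zero_of_divForm_self_eq_zero }
  let _ : NormedAddCommGroup D := core.toNormedAddCommGroup
  let _ : InnerProductSpace ℝ D := InnerProductSpace.ofCore core.toCore
  have hin : ∀ x y : D, inner ℝ x y = divForm D x y := fun _ _ => rfl
  have hone : ‖(1 : D)‖ = 1 := by
    have : ‖(1 : D)‖ ^ 2 = 1 := by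
      rw [← real_inner_self_eq_norm_sq, hin, divForm, mul_one, regTrace_one_div]; norm_num
    exact (pow_eq_one_iff_of_nonneg (norm_nonneg _) two_ne_zero).1 this
  have hmul : ∀ x y : D, ‖x * y‖ = ‖x‖ * ‖y‖ := by
    intro x y
    have : ‖x * y‖ ^ 2 = (‖x‖ * ‖y‖) ^ 2 := by
      rw [mul_pow, ← real_inner_self_eq_norm_sq, ← real_inner_self_eq_norm_sq,
        ← real_inner_self_eq_norm_sq, hin, hin, hin, divForm_mul_self]
    exact (pow_left_inj₀ (norm_nonneg _) (by positivity) two_ne_zero).1 this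
  have horth : Orthonormal ℝ ((↑) : ({1} : Set D) → D) := by
    refine ⟨fun i => ?_, fun i j hij => (hij (Subsingleton.elim _ _)).elim⟩
    rw [Set.mem_singleton_iff.1 i.2, hone]
  obtain ⟨s, u, hsub, hu⟩ := horth.exists_orthonormalBasis_extension
  have htr : ∀ i, regTrace ℝ D (u i) / Module.finrank ℝ D = inner ℝ (u i) (1 : D) := by
    intro i
    rw [hin, divForm, mul_one, regTrace_one_div]; ring
  have h1s : (1 : D) ∈ s := hsub rfl
  have hu1 : u ⟨1, h1s⟩ = 1 := by rw [hu]
  have hmulform : ∀ i j, regTrace ℝ D (u i * u j) = Module.finrank ℝ D *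
      (2 * inner ℝ (u i) (1 : D) * inner ℝ (u j) (1 : D) - inner ℝ (u i) (u j)) := by
    intro i j
    rw [← htr, ← htr, hin, divForm]; field_simp; ring
  refine ⟨s, inferInstance, u.toBasis, fun i j k => ?_, fun i j hij => ?_, fun i => ?_⟩
  · simp only [OrthonormalBasis.coe_toBasis, OrthonormalBasis.coe_toBasis_repr_apply,
      OrthonormalBasis.repr_apply_apply]
    refine (abs_real_inner_le_norm _ _).trans ?_
    rw [hmul]; simp
  · simp only [OrthonormalBasis.coe_toBasis]
    rw [hmulform, u.inner_eq_zero hij, ← hu1]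
    by_cases h : i = ⟨1, h1s⟩
    · rw [u.inner_eq_zero (i := j) (fun h' => hij (h.trans h'.symm))]; simp
    · rw [u.inner_eq_zero h]; simp
  · simp only [OrthonormalBasis.coe_toBasis]
    rw [hmulform, u.inner_eq_one, ← hu1]
    by_cases h : i = ⟨1, h1s⟩
    · rw [h, u.inner_eq_one]; norm_num
      exact Module.finrank_pos
    · rw [u.inner_eq_zero h]; simpa using hd

end RealDivision

lemma isSemisimpleRing_of_regTrace_nondegenerate {K A : Type} [Field K] [Ring A] [Algebra K A]
    [FiniteDimensional K A] (h : ∀ x : A, (∀ y, regTrace K A (x * y) = 0) → x = 0) :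
    IsSemisimpleRing A := by
  have : IsArtinianRing A := IsArtinianRing.of_finite K A
  rw [IsArtinianRing.isSemisimpleRing_iff_jacobson, eq_bot_iff]
  intro x hx
  rw [Ideal.mem_bot]
  refine h x fun y => ?_
  obtain ⟨m, hm⟩ := IsArtinianRing.isNilpotent_jacobson_bot (R := A)
  have hnil : IsNilpotent (y * x) := by
    refine ⟨m, ?_⟩
    have h1 : y * x ∈ Ideal.jacobson (⊥ : Ideal A) := Ideal.mul_mem_left _ y (by simpa [Ring.jacobson_eq_sInf_isMaximal, Ideal.jacobson] using hx)
    have h2 := Ideal.pow_mem_pow h1 m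
    rw [hm] at h2
    simpa using h2
  rw [regTrace_mul_comm, regTrace, LinearMap.comp_apply]
  have h2 : IsNilpotent (LinearMap.mul K A (y * x)) := hnil.map (Algebra.lmul K A)
  exact (LinearMap.isNilpotent_trace_of_isNilpotent h2).eq_zero

lemma Matrix.one_le_abs_det_of_monomial {ι : Type} [Fintype ι] [DecidableEq ι] (G : Matrix ι ι ℝ)
    (σ : Equiv.Perm ι) (h0 : ∀ a b, b ≠ σ a → G a b = 0) (h1 : ∀ a, 1 ≤ |G a (σ a)|) :
    1 ≤ |G.det| := by
  have hd : G.submatrix id σ = Matrix.diagonal fun a => G a (σ a) := by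
    ext a b
    by_cases hab : a = b
    · subst hab; simp
    · rw [Matrix.diagonal_apply_ne _ hab]
      exact h0 _ _ fun h => hab (σ.injective h).symm
  have h2 := Matrix.det_permute' σ G
  rw [hd, Matrix.det_diagonal] at h2
  have h3 : |G.det| = ∏ a, |G a (σ a)| := by
    rw [← Finset.abs_prod, h2, abs_mul]
    rcases Int.units_eq_one_or (Equiv.Perm.sign σ) with h | h <;> simp [h]
  rw [h3]
  simpa using Finset.prod_le_prod (s := Finset.univ) (f := fun _ => (1 : ℝ))
    (fun _ _ => zero_le_one) fun a _ => h1 a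

lemma regTrace_single_mul {K : Type} [Field K] {r : ℕ} {n : Fin r → ℕ} {D : Fin r → Type}
    [∀ k, Ring (D k)] [∀ k, Algebra K (D k)] {ι : Fin r → Type} [∀ k, Fintype (ι k)]
    (u : ∀ k, Module.Basis (ι k) K (D k)) (k : Fin r) (i j : Fin (n k)) (d : D k)
    (y : ∀ k, Matrix (Fin (n k)) (Fin (n k)) (D k)) :
    regTrace K (∀ k, Matrix (Fin (n k)) (Fin (n k)) (D k))
      (Pi.single k (Matrix.single i j d) * y) = n k * regTrace K (D k) (d * y k j i) := by
  rw [regTrace_pi_matrix u, Finset.sum_eq_single k, Finset.sum_eq_single i]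
  · simp
  · intro p _ hp
    simp [hp]
  · simp
  · intro k' _ hk
    simp [hk]
  · simp

lemma exists_basis_real_algebra (A : Type) [Ring A] [Algebra ℝ A] [FiniteDimensional ℝ A]
    (h : ∀ x : A, (∀ y, regTrace ℝ A (x * y) = 0) → x = 0) :
    ∃ E : Module.Basis (Fin (Module.finrank ℝ A)) ℝ A,
      (∀ i j k, |E.repr (E i * E j) k| ≤ 1) ∧
      1 ≤ |(Matrix.of fun i j => regTrace ℝ A (E i * E j)).det| := by
  have hss := isSemisimpleRing_of_regTrace_nondegenerate h
  obtain ⟨r, D, n, iD, iA, hf, hn, ⟨e⟩⟩ :=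
    IsSemisimpleRing.exists_algEquiv_pi_matrix_divisionRing_finite ℝ A
  choose ι hι u hu1 hu2 hu3 using fun k => exists_basis_real_divisionRing (D k)
  let E := (matBasis n u).map e.symm.toLinearEquiv
  have hE : ∀ a, E a = e.symm (matBasis n u a) := fun a => by simp [E]
  have hEr : ∀ x c, E.repr x c = (matBasis n u).repr (e x) c := fun x c => by simp [E]
  have key1 : ∀ i j k, |E.repr (E i * E j) k| ≤ 1 := by
    intro i j k
    rw [hEr, hE, hE, map_mul, e.apply_symm_apply, e.apply_symm_apply]
    exact abs_matBasis_repr_le u zero_le_one hu1 i j k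
  have htr : ∀ k i j l k' i' j' l',
      regTrace ℝ A (E ⟨k, i, j, l⟩ * E ⟨k', i', j', l'⟩) =
        n k * regTrace ℝ (D k) (u k l * matBasis n u ⟨k', i', j', l'⟩ k j i) := by
    intro k i j l k' i' j' l'
    rw [hE, hE, ← map_mul, regTrace_algEquiv, matBasis_apply u k i j l, regTrace_single_mul u]
  classical
  let σ : Equiv.Perm (Σ k, Fin (n k) × Fin (n k) × ι k) :=
    { toFun := fun a => ⟨a.1, a.2.2.1, a.2.1, a.2.2.2⟩
      invFun := fun a => ⟨a.1, a.2.2.1, a.2.1, a.2.2.2⟩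
      left_inv := fun a => rfl
      right_inv := fun a => rfl }
  have key2 : 1 ≤ |(Matrix.of fun i j => regTrace ℝ A (E i * E j)).det| := by
    refine Matrix.one_le_abs_det_of_monomial _ σ ?_ ?_
    · rintro ⟨k, i, j, l⟩ ⟨k', i', j', l'⟩ hne
      rw [Matrix.of_apply, htr, matBasis_apply]
      by_cases hk : k = k'
      · subst hk
        rw [Pi.single_eq_same, Matrix.single_apply]
        split_ifs with hij
        · obtain ⟨rfl, rfl⟩ := hij
          have : l ≠ l' := fun hl => hne (by subst hl; rfl)
          rw [hu2 _ _ _ this, mul_zero]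
        · simp
      · simp [hk]
    · rintro ⟨k, i, j, l⟩
      change 1 ≤ |(Matrix.of fun i j => regTrace ℝ A (E i * E j)) ⟨k, i, j, l⟩ ⟨k, j, i, l⟩|
      rw [Matrix.of_apply, htr, matBasis_apply, Pi.single_eq_same, Matrix.single_apply_same,
        abs_mul]
      have h1 : (1 : ℝ) ≤ |(n k : ℝ)| := by
        rw [abs_of_nonneg (Nat.cast_nonneg _)]
        exact_mod_cast Nat.one_le_iff_ne_zero.2 (hn k).out
      nlinarith [hu3 k l]
  let f := E.indexEquiv (Module.finBasis ℝ A)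
  refine ⟨E.reindex f, fun i j k => by simpa using key1 _ _ _, ?_⟩
  have : (Matrix.of fun i j => regTrace ℝ A (E.reindex f i * E.reindex f j)) =
      (Matrix.of fun i j => regTrace ℝ A (E i * E j)).submatrix f.symm f.symm := by
    ext i j; simp
  rw [this, Matrix.det_submatrix_equiv_self]
  exact key2

/-- Minkowski's theorem on linear forms. -/
lemma Matrix.exists_int_mulVec_le_one {ι : Type} [Fintype ι] [DecidableEq ι] (Q : Matrix ι ι ℝ)
    (h0 : Q.det ≠ 0) (h1 : |Q.det| < 1) :
    ∃ a : ι → ℤ, a ≠ 0 ∧ ∀ i, |(Q.mulVec fun j => (a j : ℝ)) i| ≤ 1 := by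
  have hQ : IsUnit Q := (Matrix.isUnit_iff_isUnit_det Q).2 (isUnit_iff_ne_zero.2 h0)
  have hli : LinearIndependent ℝ Q.transpose.row :=
    Matrix.linearIndependent_rows_iff_isUnit.2 (by simpa using hQ)
  have hcard : Fintype.card ι = Module.finrank ℝ (ι → ℝ) := by simp
  rcases isEmpty_or_nonempty ι with hι | hι
  · rw [Matrix.det_isEmpty] at h1; simp at h1
  let b : Module.Basis ι ℝ (ι → ℝ) := basisOfLinearIndependentOfCardEqFinrank hli hcard
  have hb : ∀ j i, b j i = Q i j := by intro j i; simp [b]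
  have hof : Matrix.of b = Q.transpose := by ext j i; simp [hb]
  have hc : Countable (Submodule.span ℤ (Set.range b)).toAddSubgroup :=
    inferInstanceAs (Countable (Submodule.span ℤ (Set.range b)))
  obtain ⟨x, hx0, hx⟩ :=
    MeasureTheory.exists_ne_zero_mem_lattice_of_measure_mul_two_pow_lt_measure
      (μ := MeasureTheory.volume) (s := Metric.closedBall (0 : ι → ℝ) 1)
      (L := (Submodule.span ℤ (Set.range b)).toAddSubgroup)
      (ZSpan.isAddFundamentalDomain' b MeasureTheory.volume) (by simp) (convex_closedBall _ _)
      (by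
        rw [ZSpan.volume_fundamentalDomain, hof, Matrix.det_transpose,
          Real.volume_pi_closedBall _ zero_le_one, Module.finrank_pi, mul_one,
          ENNReal.ofReal_pow zero_le_two, ENNReal.ofReal_ofNat]
        conv_rhs => rw [← one_mul (2 ^ _)]
        refine ENNReal.mul_lt_mul_left (by simp) (by finiteness) ?_
        simpa using h1)
  have hx' : (x : ι → ℝ) ∈ Submodule.span ℤ (Set.range b) := x.2
  rw [Submodule.mem_span_range_iff_exists_fun] at hx'
  obtain ⟨a, ha⟩ := hx'
  have hxa : ∀ i, (Q.mulVec fun j => (a j : ℝ)) i = (x : ι → ℝ) i := by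
    intro i
    rw [← ha, Finset.sum_apply]
    simp [Matrix.mulVec, dotProduct, hb, mul_comm]
  refine ⟨a, ?_, fun i => ?_⟩
  · rintro rfl
    apply hx0
    ext i
    rw [← hxa]; simp [Matrix.mulVec]
  · rw [hxa]
    have := (norm_le_pi_norm (x : ι → ℝ) i).trans (mem_closedBall_zero_iff.1 hx)
    simpa using this

/-- The integers inside the rationals. -/
abbrev intSubring : Subring ℚ := (Int.castRingHom ℚ).range

lemma mem_intSubring {q : ℚ} : q ∈ intSubring ↔ ∃ z : ℤ, (z : ℚ) = q := by
  simp [intSubring, RingHom.mem_range]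

lemma intCast_mem_intSubring (z : ℤ) : (z : ℚ) ∈ intSubring := mem_intSubring.2 ⟨z, rfl⟩

lemma one_le_abs_of_mem_intSubring {q : ℚ} (h : q ∈ intSubring) (h0 : q ≠ 0) : 1 ≤ |q| := by
  obtain ⟨z, rfl⟩ := mem_intSubring.1 h
  have : z ≠ 0 := by rintro rfl; simp at h0
  exact_mod_cast Int.one_le_abs this

lemma Matrix.det_mem_subring {R ι : Type} [CommRing R] [Fintype ι] [DecidableEq ι] (T : Subring R)
    {M : Matrix ι ι R} (h : ∀ i j, M i j ∈ T) : M.det ∈ T := by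
  rw [Matrix.det_apply]
  refine sum_mem fun σ _ => ?_
  rw [Units.smul_def]
  exact zsmul_mem (prod_mem fun i _ => h _ _) _

lemma Matrix.adjugate_mem_subring {R ι : Type} [CommRing R] [Fintype ι] [DecidableEq ι]
    (T : Subring R) {M : Matrix ι ι R} (h : ∀ i j, M i j ∈ T) (i j : ι) : M.adjugate i j ∈ T := by
  rw [Matrix.adjugate_apply]
  refine Matrix.det_mem_subring T fun p q => ?_
  by_cases hp : p = j
  · subst hp
    rw [Matrix.updateRow_self, Pi.single_apply]
    split_ifs
    exacts [T.one_mem, T.zero_mem]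
  · rw [Matrix.updateRow_ne hp]
    exact h _ _

/-- A full lattice in a finite-dimensional rational vector space has a basis. -/
lemma exists_basis_of_lattice {V : Type} [AddCommGroup V] [Module ℚ V] [FiniteDimensional ℚ V]
    (L : AddSubgroup V) (hfg : L.FG) (hfull : ∀ v : V, ∃ m : ℕ, 0 < m ∧ m • v ∈ L) :
    ∃ b : Module.Basis (Fin (Module.finrank ℚ V)) ℚ V,
      ∀ x, x ∈ L ↔ ∀ i, b.repr x i ∈ intSubring := by
  let M : Submodule ℤ V := AddSubgroup.toIntSubmodule L
  have hM : Submodule.IsLattice ℚ M := by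
    refine ⟨?_, ?_⟩
    · exact (Submodule.fg_iff_addSubgroup_fg M).2 hfg
    · rw [eq_top_iff]
      intro v _
      obtain ⟨m, hm, hv⟩ := hfull v
      have hm' : (m : ℚ) ≠ 0 := by positivity
      have h1 : (m • v : V) ∈ Submodule.span ℚ (M : Set V) := Submodule.subset_span hv
      have h2 := Submodule.smul_mem _ (m : ℚ)⁻¹ h1
      rwa [← Nat.cast_smul_eq_nsmul ℚ, smul_smul, inv_mul_cancel₀ hm', one_smul] at h2
  have hfree : Module.Free ℤ M := Submodule.IsLattice.free ℚ M
  have hfin : Module.Finite ℤ M := Submodule.IsLattice.finite ℚ M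
  have hrank : Module.finrank ℤ M = Module.finrank ℚ V :=
    by
    rw [Module.finrank, Submodule.IsLattice.rank' ℚ M, Module.finrank]
  let b₀ := (Module.finBasis ℤ M).reindex (finCongr hrank)
  let b := b₀.extendOfIsLattice ℚ
  have hb : ∀ i, b i = (b₀ i : V) := fun i => Module.Basis.extendOfIsLattice_apply ℚ b₀ i
  refine ⟨b, fun x => ⟨fun hx i => ?_, fun hx => ?_⟩⟩
  · have hx' : x ∈ M := hx
    have h1 : x = ∑ j, ((b₀.repr ⟨x, hx'⟩ j : ℤ) : ℚ) • b j := by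
      have := congrArg (Subtype.val) (b₀.sum_repr ⟨x, hx'⟩)
      simp only [Submodule.coe_sum, Submodule.coe_smul] at this
      simp only [hb, Int.cast_smul_eq_zsmul, this]
    rw [h1, Module.Basis.repr_sum_self]
    exact intCast_mem_intSubring _
  · choose z hz using fun i => mem_intSubring.1 (hx i)
    rw [← b.sum_repr x]
    refine sum_mem fun i _ => ?_
    rw [← hz, Int.cast_smul_eq_zsmul, hb]
    exact zsmul_mem (b₀ i).2 _

/-- A full order whose dual under the trace form is contained in `Δ⁻¹ Λ`. -/
structure IsGoodOrder {B : Type} [Ring B] [Algebra ℚ B] (Λ : Subring B) (Δ : ℕ) : Prop where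
  pos : 0 < Δ
  fg : Λ.toAddSubgroup.FG
  full : ∀ b : B, ∃ m : ℕ, 0 < m ∧ m • b ∈ Λ
  dual : ∀ b : B, (∀ x ∈ Λ, regTrace ℚ B (b * x) ∈ intSubring) → Δ • b ∈ Λ

lemma regTrace_mem_of_mem {B ι : Type} [Ring B] [Algebra ℚ B] [Fintype ι] (Λ : Subring B)
    (b : Module.Basis ι ℚ B) (hb : ∀ x, x ∈ Λ ↔ ∀ i, b.repr x i ∈ intSubring) {x : B}
    (hx : x ∈ Λ) : regTrace ℚ B x ∈ intSubring := by
  rw [regTrace_eq_sum_repr b]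
  refine sum_mem fun i _ => (hb _).1 (Λ.mul_mem hx ((hb _).2 fun j => ?_)) i
  classical
  rw [Module.Basis.repr_self, Finsupp.single_apply]
  split_ifs
  exacts [intSubring.one_mem, intSubring.zero_mem]

/-- The Gram matrix of the trace form. -/
noncomputable def regGram (K : Type) {A ι : Type} [CommRing K] [Ring A] [Algebra K A] (b : ι → A) :
    Matrix ι ι K := Matrix.of fun i j => regTrace K A (b i * b j)

lemma regTrace_sum_smul_mul {K A ι : Type} [CommRing K] [Ring A] [Algebra K A] [Fintype ι]
    (b : ι → A) (v : ι → K) (j : ι) :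
    regTrace K A ((∑ i, v i • b i) * b j) = Matrix.vecMul v (regGram K b) j := by
  simp [Finset.sum_mul, regGram, Matrix.vecMul, dotProduct]

lemma regGram_det_ne_zero_iff {K A ι : Type} [Field K] [Ring A] [Algebra K A] [Fintype ι]
    [DecidableEq ι] (b : Module.Basis ι K A) :
    (regGram K b).det ≠ 0 ↔ ∀ x : A, (∀ y, regTrace K A (x * y) = 0) → x = 0 := by
  rw [Ne, ← Matrix.exists_vecMul_eq_zero_iff]
  constructor
  · intro h x hx
    by_contra hx0
    refine h ⟨b.repr x, fun h0 => hx0 ?_, ?_⟩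
    · exact b.repr.map_eq_zero_iff.1 (DFunLike.coe_injective h0)
    · ext j
      rw [← regTrace_sum_smul_mul, b.sum_repr, hx]; rfl
  · rintro h ⟨v, hv, hv0⟩
    apply hv
    have h1 : ∑ i, v i • b i = 0 := by
      refine h _ fun y => ?_
      rw [← b.sum_repr y, Finset.mul_sum, map_sum]
      refine Finset.sum_eq_zero fun j _ => ?_
      rw [mul_smul_comm, map_smul, regTrace_sum_smul_mul, hv0]; simp
    funext i
    exact Fintype.linearIndependent_iff.1 b.linearIndependent v h1 i

/-- The Gram determinant of a good order is bounded. -/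
lemma IsGoodOrder.abs_det_regGram_le {B ι : Type} [Ring B] [Algebra ℚ B] [Fintype ι]
    [DecidableEq ι] {Λ : Subring B} {Δ : ℕ} (h : IsGoodOrder Λ Δ) (b : Module.Basis ι ℚ B)
    (hb : ∀ x, x ∈ Λ ↔ ∀ i, b.repr x i ∈ intSubring)
    (hnd : (regGram ℚ b).det ≠ 0) : |(regGram ℚ b).det| ≤ (Δ : ℚ) ^ Fintype.card ι := by
  set G := regGram ℚ b with hG
  have hu : IsUnit G.det := isUnit_iff_ne_zero.2 hnd
  have hint : ∀ i j, ((Δ : ℚ) • G⁻¹) i j ∈ intSubring := by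
    intro i j
    have h1 : Δ • (∑ k, G⁻¹ i k • b k) ∈ Λ := by
      refine h.dual _ fun x hx => ?_
      rw [← b.sum_repr x, Finset.mul_sum, map_sum]
      refine sum_mem fun k _ => ?_
      rw [mul_smul_comm, map_smul, regTrace_sum_smul_mul, smul_eq_mul]
      refine mul_mem ((hb x).1 hx k) ?_
      have : Matrix.vecMul (G⁻¹ i) G k = (G⁻¹ * G) i k := by
        rw [Matrix.mul_apply]; rfl
      rw [← hG, this, Matrix.nonsing_inv_mul _ hu, Matrix.one_apply]
      split_ifs
      exacts [intSubring.one_mem, intSubring.zero_mem]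
    have h2 := (hb _).1 h1 j
    rw [← Nat.cast_smul_eq_nsmul ℚ, map_smul, Finsupp.smul_apply, Module.Basis.repr_sum_self] at h2
    simpa using h2
  have hΔ : (Δ : ℚ) ≠ 0 := by exact_mod_cast h.pos.ne'
  have hdet := Matrix.det_mem_subring intSubring hint
  rw [Matrix.det_smul, Matrix.det_nonsing_inv, Ring.inverse_eq_inv'] at hdet
  have h3 := one_le_abs_of_mem_intSubring hdet (mul_ne_zero (pow_ne_zero _ hΔ) (inv_ne_zero hnd))
  rw [abs_mul, abs_inv, abs_of_nonneg (by positivity), ← div_eq_mul_inv,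
    one_le_div (abs_pos.2 hnd)] at h3
  exact h3

lemma Matrix.exists_short_vector (d : ℕ) (hd : 0 < d) {c V : ℝ} (hc : 0 < c) (hV : 0 ≤ V) :
    ∃ R : ℝ, 0 < R ∧ ∀ P : Matrix (Fin d) (Fin d) ℝ, P.det ≠ 0 → |P.det| ≤ V →
      (∀ a : Fin d → ℤ, a ≠ 0 → ∃ i, c < |(P.mulVec fun j => (a j : ℝ)) i|) →
      ∀ l : Fin d → ℝ, l ≠ 0 → ∃ a : Fin d → ℤ,
        (∀ i, |(P.mulVec fun j => (a j : ℝ)) i| ≤ R) ∧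
        dotProduct l (P.mulVec fun j => (a j : ℝ)) ≠ 0 := by
  set ε : ℝ := c / d with hε
  have hdpos : (0 : ℝ) < d := by exact_mod_cast hd
  have hεpos : 0 < ε := by positivity
  have hεc : ε ≤ c := div_le_self hc.le (by exact_mod_cast hd)
  set H : ℝ := (V + 1) * ε⁻¹ ^ (d - 1) with hH
  have hHpos : 0 < H := by positivity
  refine ⟨H + c, by positivity, fun P hP hPV hmin l hl => ?_⟩
  have : Nonempty (Fin d) := ⟨⟨0, hd⟩⟩
  obtain ⟨i, hi⟩ := Finite.exists_max fun j => |l j|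
  have hli : l i ≠ 0 := by
    intro h0
    apply hl
    funext j
    have := hi j
    rw [h0, abs_zero] at this
    simpa using abs_nonpos_iff.1 this
  set l' : Fin d → ℝ := (l i)⁻¹ • l with hl'
  have hl'i : l' i = 1 := by simp [hl', hli]
  have hl'j : ∀ j, |l' j| ≤ 1 := by
    intro j
    rw [hl', Pi.smul_apply, smul_eq_mul, abs_mul, abs_inv, inv_mul_le_iff₀ (abs_pos.2 hli), mul_one]
    exact hi j
  let w : Fin d → ℝ := Function.update (fun _ => ε⁻¹) i H⁻¹
  have hw : ∏ j, w j = (V + 1)⁻¹ := by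
    rw [Finset.prod_update_of_mem (Finset.mem_univ i), Finset.prod_const]
    have : (Finset.univ \ {i} : Finset (Fin d)).card = d - 1 := by
      rw [Finset.card_sdiff_of_subset (Finset.subset_univ _)]; simp
    rw [this, hH, mul_inv, mul_assoc, inv_mul_cancel₀ (by positivity), mul_one]
  let T : Matrix (Fin d) (Fin d) ℝ := (1 : Matrix (Fin d) (Fin d) ℝ).updateRow i l'
  have hT : T.det = 1 := by
    have := Matrix.cramer_transpose_apply (1 : Matrix (Fin d) (Fin d) ℝ) l' i
    rw [Matrix.transpose_one, Matrix.cramer_one] at this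
    rw [← this]; exact hl'i
  have hQ : (Matrix.diagonal w * T * P).det = (V + 1)⁻¹ * P.det := by
    rw [Matrix.det_mul, Matrix.det_mul, Matrix.det_diagonal, hw, hT, mul_one]
  obtain ⟨a, ha0, ha⟩ := Matrix.exists_int_mulVec_le_one (Matrix.diagonal w * T * P)
    (by rw [hQ]; exact mul_ne_zero (by positivity) hP)
    (by
      rw [hQ, abs_mul, abs_inv, abs_of_pos (by positivity : 0 < V + 1),
        inv_mul_lt_iff₀ (by positivity)]
      linarith)
  set X := P.mulVec fun j => (a j : ℝ) with hX
  have hval : ∀ j, ((Matrix.diagonal w * T * P).mulVec fun j => (a j : ℝ)) j =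
      w j * (T.mulVec X) j := by
    intro j
    rw [← Matrix.mulVec_mulVec, ← Matrix.mulVec_mulVec, Matrix.mulVec_diagonal]
  have hXj : ∀ j, j ≠ i → |X j| ≤ ε := by
    intro j hj
    have h1 := ha j
    rw [hval] at h1
    have h2 : (T.mulVec X) j = X j := by
      simp only [T, Matrix.mulVec, Matrix.updateRow_ne hj]
      exact congrFun (Matrix.one_mulVec X) j
    rw [h2, show w j = ε⁻¹ from Function.update_of_ne hj _ _, abs_mul, abs_inv, abs_of_pos hεpos,
      inv_mul_le_iff₀ hεpos, mul_one] at h1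
    exact h1
  have hlX : |dotProduct l' X| ≤ H := by
    have h1 := ha i
    rw [hval] at h1
    have h2 : (T.mulVec X) i = dotProduct l' X := by
      simp only [T, Matrix.mulVec, Matrix.updateRow_self]
    rw [h2, show w i = H⁻¹ from Function.update_self _ _ _, abs_mul, abs_inv, abs_of_pos hHpos,
      inv_mul_le_iff₀ hHpos, mul_one] at h1
    exact h1
  have hrest : |dotProduct l' X - X i| ≤ c := by
    rw [dotProduct, ← Finset.add_sum_erase _ _ (Finset.mem_univ i), hl'i, one_mul,
      add_sub_cancel_left]
    calc |∑ j ∈ Finset.univ.erase i, l' j * X j| ≤ ∑ j ∈ Finset.univ.erase i, |l' j * X j| :=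
          Finset.abs_sum_le_sum_abs _ _
      _ ≤ ∑ j ∈ Finset.univ.erase i, ε := by
          refine Finset.sum_le_sum fun j hj => ?_
          rw [abs_mul]
          have := hXj j (Finset.ne_of_mem_erase hj)
          calc _ ≤ 1 * ε := mul_le_mul (hl'j j) this (abs_nonneg _) zero_le_one
            _ = ε := one_mul _
      _ ≤ ∑ j : Fin d, ε := Finset.sum_le_sum_of_subset_of_nonneg (Finset.subset_univ _)
          fun _ _ _ => hεpos.le
      _ = c := by
        rw [Finset.sum_const, Finset.card_univ, Fintype.card_fin, nsmul_eq_mul, hε]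
        field_simp
  refine ⟨a, fun j => ?_, fun h0 => ?_⟩
  · by_cases hj : j = i
    · subst hj
      have := abs_sub_abs_le_abs_sub (X j) (dotProduct l' X)
      rw [abs_sub_comm] at this
      linarith
    · linarith [hXj j hj]
  · obtain ⟨j, hj⟩ := hmin a ha0
    have h0' : dotProduct l' X = 0 := by rw [hl', smul_dotProduct, h0, smul_zero]
    by_cases hji : j = i
    · subst hji
      rw [h0', zero_sub, abs_neg] at hrest
      linarith
    · linarith [hXj j hji]

lemma regTrace_one_tmul (K L A : Type) [Field K] [Field L] [Algebra K L] [Ring A] [Algebra K A]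
    [FiniteDimensional K A] (x : A) :
    regTrace L (L ⊗[K] A) (1 ⊗ₜ x) = algebraMap K L (regTrace K A x) := by
  let b := Module.finBasis K A
  rw [regTrace_eq_sum_repr (b.baseChange L), regTrace_eq_sum_repr b, map_sum]
  refine Finset.sum_congr rfl fun i _ => ?_
  rw [Module.Basis.baseChange_apply, Algebra.TensorProduct.tmul_mul_tmul, one_mul,
    Module.Basis.baseChange_repr_tmul, Algebra.smul_def, mul_one]

section Coordinates

variable {A : Type} [Ring A] [Algebra ℝ A] {d : ℕ} (E : Module.Basis (Fin d) ℝ A)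
  (hE : ∀ i j k, |E.repr (E i * E j) k| ≤ 1)

include hE in
lemma abs_repr_mul_le {x y : A} {R S : ℝ} (hx : ∀ i, |E.repr x i| ≤ R) (hy : ∀ i, |E.repr y i| ≤ S)
    (k : Fin d) : |E.repr (x * y) k| ≤ d * d * (R * S) := by
  conv_lhs => rw [← E.sum_repr x, ← E.sum_repr y, Finset.sum_mul_sum]
  simp only [smul_mul_smul_comm, map_sum, map_smul, Finsupp.coe_finsetSum, Finset.sum_apply,
    Finsupp.smul_apply, smul_eq_mul]
  calc _ ≤ ∑ i, ∑ j, |E.repr x i * E.repr y j * E.repr (E i * E j) k| :=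
        (Finset.abs_sum_le_sum_abs _ _).trans
          (Finset.sum_le_sum fun i _ => Finset.abs_sum_le_sum_abs _ _)
    _ ≤ ∑ i : Fin d, ∑ j : Fin d, R * S := by
        refine Finset.sum_le_sum fun i _ => Finset.sum_le_sum fun j _ => ?_
        have hR := (abs_nonneg _).trans (hx i)
        rw [abs_mul, abs_mul]
        calc _ ≤ R * S * 1 := mul_le_mul (mul_le_mul (hx i) (hy j) (abs_nonneg _) hR) (hE i j k)
              (abs_nonneg _) (mul_nonneg hR ((abs_nonneg _).trans (hy j)))
          _ = R * S := mul_one _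
    _ = _ := by simp; ring

lemma abs_repr_self_le (i j : Fin d) : |E.repr (E i) j| ≤ 1 := by
  rw [Module.Basis.repr_self, Finsupp.single_apply]
  split_ifs <;> simp

include hE in
lemma abs_regTrace_le {x : A} {R : ℝ} (hx : ∀ i, |E.repr x i| ≤ R) :
    |regTrace ℝ A x| ≤ d * (d * d * R) := by
  rw [regTrace_eq_sum_repr E]
  calc _ ≤ ∑ i, |E.repr (x * E i) i| := Finset.abs_sum_le_sum_abs _ _
    _ ≤ ∑ i : Fin d, d * d * R := by
        refine Finset.sum_le_sum fun i _ => ?_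
        simpa using abs_repr_mul_le E hE hx (abs_repr_self_le E i) i
    _ = _ := by simp

include hE in
lemma abs_det_mul_le {x : A} {R : ℝ} (hx : ∀ i, |E.repr x i| ≤ R) :
    |LinearMap.det (LinearMap.mul ℝ A x)| ≤ d.factorial * (d * d * R) ^ d := by
  rw [← LinearMap.det_toMatrix E]
  have := Matrix.det_le (A := LinearMap.toMatrix E E (LinearMap.mul ℝ A x))
    (abv := IsAbsoluteValue.toAbsoluteValue (abs : ℝ → ℝ)) (x := d * d * R) (fun i j => by
      rw [LinearMap.toMatrix_apply]
      simpa using abs_repr_mul_le E hE hx (abs_repr_self_le E j) i)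
  simpa using this

end Coordinates

/-- The determinant of left multiplication. -/
noncomputable def regNorm (K A : Type) [CommRing K] [Ring A] [Algebra K A] : A →* K :=
  LinearMap.det.comp ((Algebra.lmul K A : A →ₐ[K] Module.End K A) : A →* Module.End K A)

lemma regNorm_apply (K A : Type) [CommRing K] [Ring A] [Algebra K A] (x : A) :
    regNorm K A x = LinearMap.det (LinearMap.mul K A x) := rfl

lemma regNorm_ne_zero {K D : Type} [Field K] [DivisionRing D] [Algebra K D] {x : D} (hx : x ≠ 0) :
    regNorm K D x ≠ 0 := by
  intro h
  have := (regNorm K D).map_mul x x⁻¹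
  rw [mul_inv_cancel₀ hx, map_one, h, zero_mul] at this
  exact one_ne_zero this

lemma regNorm_mem_of_mem {B ι : Type} [Ring B] [Algebra ℚ B] [Fintype ι] (Λ : Subring B)
    (b : Module.Basis ι ℚ B) (hb : ∀ x, x ∈ Λ ↔ ∀ i, b.repr x i ∈ intSubring) {x : B}
    (hx : x ∈ Λ) : regNorm ℚ B x ∈ intSubring := by
  classical
  rw [regNorm_apply, ← LinearMap.det_toMatrix b]
  refine Matrix.det_mem_subring _ fun i j => ?_
  rw [LinearMap.toMatrix_apply]
  refine (hb _).1 (Λ.mul_mem hx ((hb _).2 fun k => ?_)) i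
  rw [Module.Basis.repr_self, Finsupp.single_apply]
  split_ifs
  exacts [intSubring.one_mem, intSubring.zero_mem]

lemma regNorm_one_tmul (D : Type) [Ring D] [Algebra ℚ D] [FiniteDimensional ℚ D] (x : D) :
    regNorm ℝ (ℝ ⊗[ℚ] D) (1 ⊗ₜ x) = (regNorm ℚ D x : ℝ) := by
  have : LinearMap.mul ℝ (ℝ ⊗[ℚ] D) (1 ⊗ₜ x) = (LinearMap.mul ℚ D x).baseChange ℝ := by
    ext y; simp
  rw [regNorm_apply, this, LinearMap.det_baseChange]; rfl

lemma regTrace_nondegenerate_of_divisionRing (D : Type) [DivisionRing D] [Algebra ℚ D]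
    [FiniteDimensional ℚ D] (x : D) (hx : ∀ y, regTrace ℚ D (x * y) = 0) : x = 0 := by
  by_contra h0
  have h1 := hx x⁻¹
  rw [mul_inv_cancel₀ h0, ← map_one (algebraMap ℚ D), regTrace_algebraMap, mul_one] at h1
  exact Module.finrank_pos.ne' (Nat.cast_injective (R := ℚ) (by simpa using h1))

lemma exists_basis_real_algebra_fin (A : Type) [Ring A] [Algebra ℝ A] [FiniteDimensional ℝ A]
    (h : ∀ x : A, (∀ y, regTrace ℝ A (x * y) = 0) → x = 0) {d : ℕ}
    (hd : Module.finrank ℝ A = d) :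
    ∃ E : Module.Basis (Fin d) ℝ A, (∀ i j k, |E.repr (E i * E j) k| ≤ 1) ∧
      1 ≤ |(regGram ℝ E).det| := by
  subst hd
  exact exists_basis_real_algebra A h

lemma regGram_eq_transpose_mul {K A ι : Type} [CommRing K] [Ring A] [Algebra K A] [Fintype ι]
    (E : Module.Basis ι K A) (b : ι → A) :
    regGram K b = (E.toMatrix b).transpose * regGram K E * E.toMatrix b := by
  ext i j
  conv_lhs => rw [regGram, Matrix.of_apply, ← E.sum_repr (b i), ← E.sum_repr (b j)]
  rw [Finset.mul_sum, map_sum, Matrix.mul_apply]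
  refine Finset.sum_congr rfl fun k _ => ?_
  rw [mul_smul_comm, map_smul, regTrace_sum_smul_mul, smul_eq_mul, mul_comm]
  rfl

lemma exists_short_basis_real (d Δ : ℕ) (hd : 0 < d) :
    ∃ R : ℝ, 0 < R ∧ ∀ (D : Type) [DivisionRing D] [Algebra ℚ D] [FiniteDimensional ℚ D],
      Module.finrank ℚ D = d → ∀ S : Subring D, IsGoodOrder S Δ →
      ∃ E : Module.Basis (Fin d) ℝ (ℝ ⊗[ℚ] D), (∀ i j k, |E.repr (E i * E j) k| ≤ 1) ∧
        ∃ b : Module.Basis (Fin d) ℚ D, (∀ x, x ∈ S ↔ ∀ i, b.repr x i ∈ intSubring) ∧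
        ∃ s : Module.Basis (Fin d) ℚ D, (∀ k, s k ∈ S) ∧
          ∀ k i, |E.repr (1 ⊗ₜ s k) i| ≤ R := by
  have hdpos : (0 : ℝ) < d := by exact_mod_cast hd
  obtain ⟨c, hc, hcd⟩ : ∃ c : ℝ, 0 < c ∧ (d.factorial : ℝ) * (d * d * c) ^ d < 1 := by
    have hf : (1 : ℝ) ≤ d.factorial := by exact_mod_cast Nat.one_le_iff_ne_zero.2 d.factorial_ne_zero
    refine ⟨1 / (d * d * (2 * d.factorial)), by positivity, ?_⟩
    have h1 : (d * d * (1 / (d * d * (2 * d.factorial))) : ℝ) = 1 / (2 * d.factorial) := by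
      field_simp
    rw [h1]
    have h2 : (1 / (2 * d.factorial) : ℝ) ^ d ≤ 1 / (2 * d.factorial) :=
      pow_le_of_le_one (by positivity) (by rw [div_le_one (by positivity)]; linarith) hd.ne'
    calc _ ≤ (d.factorial : ℝ) * (1 / (2 * d.factorial)) := by gcongr
      _ = 1 / 2 := by field_simp
      _ < 1 := by norm_num
  obtain ⟨R, hR, hshort⟩ := Matrix.exists_short_vector d hd hc
    (show (0 : ℝ) ≤ (Δ : ℝ) ^ d by positivity)
  refine ⟨R, hR, ?_⟩
  intro D _ _ _ hfin S hS
  obtain ⟨b, hb⟩ : ∃ b : Module.Basis (Fin d) ℚ D,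
      ∀ x, x ∈ S ↔ ∀ i, b.repr x i ∈ intSubring := by
    subst hfin
    exact exists_basis_of_lattice S.toAddSubgroup hS.fg hS.full
  have hnd := (regGram_det_ne_zero_iff b).2 (regTrace_nondegenerate_of_divisionRing D)
  have hGle := hS.abs_det_regGram_le b hb hnd
  let bR := b.baseChange ℝ
  have hbR : ∀ i, bR i = 1 ⊗ₜ b i := fun i => Module.Basis.baseChange_apply ℝ b i
  have hGram : regGram ℝ bR = (regGram ℚ b).map (algebraMap ℚ ℝ) := by
    ext i j
    simp only [regGram, Matrix.of_apply, hbR, Matrix.map_apply, Algebra.TensorProduct.tmul_mul_tmul,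
      one_mul, regTrace_one_tmul]
  have hGramdet : (regGram ℝ bR).det = ((regGram ℚ b).det : ℝ) := by
    rw [hGram, ← RingHom.mapMatrix_apply, ← RingHom.map_det]; rfl
  have hndR : (regGram ℝ bR).det ≠ 0 := by rw [hGramdet]; exact_mod_cast hnd
  obtain ⟨E, hE1, hE2⟩ := exists_basis_real_algebra_fin (ℝ ⊗[ℚ] D)
    ((regGram_det_ne_zero_iff bR).1 hndR) ((Module.finrank_baseChange (R := ℝ)).trans hfin)
  set P := E.toMatrix bR with hP
  have hPdet : (regGram ℝ bR).det = P.det ^ 2 * (regGram ℝ E).det := by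
    rw [regGram_eq_transpose_mul E bR, Matrix.det_mul, Matrix.det_mul, Matrix.det_transpose]; ring
  have hP0 : P.det ≠ 0 := by
    intro h; rw [h] at hPdet; exact hndR (by rw [hPdet]; ring)
  have hPle : |P.det| ≤ (Δ : ℝ) ^ d := by
    have h1 : P.det ^ 2 ≤ (Δ : ℝ) ^ d := by
      have h2 : |((regGram ℚ b).det : ℝ)| ≤ (Δ : ℝ) ^ d := by
        have : ((|(regGram ℚ b).det| : ℚ) : ℝ) ≤ (((Δ : ℚ) ^ Fintype.card (Fin d) : ℚ) : ℝ) := by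
          exact_mod_cast hGle
        simpa using this
      rw [← hGramdet, hPdet, abs_mul, abs_of_nonneg (sq_nonneg _)] at h2
      nlinarith [sq_nonneg P.det]
    have hΔ : (1 : ℝ) ≤ (Δ : ℝ) ^ d := one_le_pow₀ (by exact_mod_cast hS.pos)
    rw [← sq_abs] at h1
    nlinarith [abs_nonneg P.det]
  have hcoord : ∀ a : Fin d → ℚ, ∀ i,
      E.repr (1 ⊗ₜ (∑ j, a j • b j)) i = (P.mulVec fun j => (a j : ℝ)) i := by
    intro a i
    rw [TensorProduct.tmul_sum, map_sum, Finsupp.finsetSum_apply, Matrix.mulVec, dotProduct]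
    refine Finset.sum_congr rfl fun j _ => ?_
    have : (1 : ℝ) ⊗ₜ[ℚ] (a j • b j) = (a j : ℝ) • bR j := by
      rw [hbR, ← TensorProduct.smul_tmul, TensorProduct.smul_tmul', Rat.smul_def, smul_eq_mul]
    rw [this, map_smul, Finsupp.smul_apply, smul_eq_mul, mul_comm]; rfl
  have hcoordZ : ∀ a : Fin d → ℤ, ∀ i,
      E.repr (1 ⊗ₜ (∑ j, (a j : ℚ) • b j)) i = (P.mulVec fun j => (a j : ℝ)) i := by
    intro a i
    rw [hcoord]; simp
  have hmem : ∀ a : Fin d → ℤ, ∑ j, (a j : ℚ) • b j ∈ S := by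
    intro a
    rw [hb]
    intro i
    rw [Module.Basis.repr_sum_self]
    exact intCast_mem_intSubring _
  have hmin : ∀ a : Fin d → ℤ, a ≠ 0 → ∃ i, c < |(P.mulVec fun j => (a j : ℝ)) i| := by
    intro a ha
    by_contra! hcon
    have h1 := abs_det_mul_le E hE1 (x := 1 ⊗ₜ (∑ j, (a j : ℚ) • b j)) (R := c)
      (fun i => by rw [hcoordZ]; exact hcon i)
    rw [← regNorm_apply, regNorm_one_tmul] at h1
    have h2 : ∑ j, (a j : ℚ) • b j ≠ 0 := by
      intro h0
      apply ha
      funext j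
      have := Fintype.linearIndependent_iff.1 b.linearIndependent _ h0 j
      exact_mod_cast this
    have h3 := one_le_abs_of_mem_intSubring (regNorm_mem_of_mem S b hb (hmem a))
      (regNorm_ne_zero h2)
    have h4 : (1 : ℝ) ≤ |(regNorm ℚ D (∑ j, (a j : ℚ) • b j) : ℝ)| := by exact_mod_cast h3
    linarith
  let W : Set D := {x | x ∈ S ∧ ∀ i, |E.repr (1 ⊗ₜ x) i| ≤ R}
  have hspan : Submodule.span ℚ W = ⊤ := by
    by_contra hne
    obtain ⟨f, hf0, hf⟩ := Submodule.exists_le_ker_of_lt_top _ (lt_top_iff_ne_top.2 hne)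
    let fv : Fin d → ℝ := fun j => (f (b j) : ℝ)
    let l : Fin d → ℝ := Matrix.vecMul fv P⁻¹
    have hlX : ∀ a : Fin d → ℤ, dotProduct l (P.mulVec fun j => (a j : ℝ)) =
        (f (∑ j, (a j : ℚ) • b j) : ℝ) := by
      intro a
      rw [Matrix.dotProduct_mulVec, Matrix.vecMul_vecMul,
        Matrix.nonsing_inv_mul _ (isUnit_iff_ne_zero.2 hP0), Matrix.vecMul_one]
      simp [dotProduct, fv, mul_comm]
    have hl0 : l ≠ 0 := by
      intro h0
      apply hf0
      refine b.ext fun j => ?_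
      have := hlX (Pi.single j 1)
      rw [h0, zero_dotProduct] at this
      have h2 : ∑ k, ((Pi.single j 1 : Fin d → ℤ) k : ℚ) • b k = b j := by
        rw [Finset.sum_eq_single j]
        · simp
        · intro k _ hk; simp [hk]
        · simp
      rw [h2] at this
      exact_mod_cast this.symm
    obtain ⟨a, ha, ha0⟩ := hshort P hP0 hPle hmin l hl0
    rw [hlX] at ha0
    apply ha0
    have : ∑ j, (a j : ℚ) • b j ∈ W := ⟨hmem a, fun i => by rw [hcoordZ]; exact ha i⟩
    have := LinearMap.mem_ker.1 (hf (Submodule.subset_span this))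
    rw [this]; simp
  obtain ⟨g, hg, hgs, hgi⟩ := Submodule.exists_fun_fin_finrank_span_eq ℚ W
  have hcard : Module.finrank ℚ (Submodule.span ℚ W) = d := by
    rw [hspan, finrank_top, hfin]
  let s := (Module.Basis.mk hgi (hgs.trans hspan).ge).reindex (finCongr hcard)
  have hs : ∀ k, s k ∈ W := by
    intro k
    simp only [s, Module.Basis.reindex_apply, Module.Basis.mk_apply]
    exact hg _
  exact ⟨E, hE1, b, hb, s, fun k => (hs k).1, fun k => (hs k).2⟩

lemma abs_repr_le_of_regGram {B : Type} [Ring B] [Algebra ℚ B] {d : ℕ}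
    (s : Module.Basis (Fin d) ℚ B) (hdet : 1 ≤ |(regGram ℚ s).det|) {K : ℚ}
    (hK : ∀ i j, |regTrace ℚ B (s i * s j)| ≤ K) (w : B)
    (hw : ∀ k, |regTrace ℚ B (w * s k)| ≤ K) (l : Fin d) :
    |s.repr w l| ≤ d.factorial * K ^ d := by
  have h1 := Matrix.det_updateRow_sum (regGram ℚ s) l (s.repr w)
  have h2 : |((regGram ℚ s).updateRow l (∑ k, s.repr w k • regGram ℚ s k)).det| ≤
      d.factorial * K ^ d := by
    have := Matrix.det_le (A := (regGram ℚ s).updateRow l (∑ k, s.repr w k • regGram ℚ s k))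
      (abv := IsAbsoluteValue.toAbsoluteValue (abs : ℚ → ℚ)) (x := K) (fun i j => by
        by_cases hi : i = l
        · subst hi
          rw [Matrix.updateRow_self]
          have h3 : (∑ k, s.repr w k • regGram ℚ s k) j = regTrace ℚ B (w * s j) := by
            conv_rhs => rw [← s.sum_repr w, regTrace_sum_smul_mul]
            rw [Finset.sum_apply]; rfl
          rw [h3]
          exact hw j
        · rw [Matrix.updateRow_ne hi]
          exact hK i j)
    simpa using this
  rw [h1, smul_eq_mul, abs_mul] at h2
  calc |s.repr w l| = |s.repr w l| * 1 := (mul_one _).symm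
    _ ≤ |s.repr w l| * |(regGram ℚ s).det| := by gcongr
    _ ≤ _ := h2

lemma exists_short_basis_of_finrank_eq (d Δ : ℕ) (hd : 0 < d) :
    ∃ C : ℕ, ∀ (D : Type) [DivisionRing D] [Algebra ℚ D] [FiniteDimensional ℚ D],
      Module.finrank ℚ D = d → ∀ S : Subring D, IsGoodOrder S Δ →
      ∃ s : Module.Basis (Fin d) ℚ D, (∀ k, s k ∈ S) ∧
        ∀ i j k, |s.repr (s i * s j) k| ≤ C := by
  obtain ⟨R, hR, h⟩ := exists_short_basis_real d Δ hd
  obtain ⟨K₁, hK₁⟩ := exists_nat_ge ((d : ℝ) * (d * d * (d * d * (R * R))))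
  obtain ⟨K₂, hK₂⟩ := exists_nat_ge ((d : ℝ) * (d * d * (d * d * (d * d * (R * R) * R))))
  refine ⟨d.factorial * (K₁ + K₂) ^ d, ?_⟩
  intro D _ _ _ hfin S hS
  obtain ⟨E, hE, b, hb, s, hsS, hs⟩ := h D hfin S hS
  have hdet : 1 ≤ |(regGram ℚ s).det| := by
    refine one_le_abs_of_mem_intSubring (Matrix.det_mem_subring _ fun i j => ?_)
      ((regGram_det_ne_zero_iff s).2 (regTrace_nondegenerate_of_divisionRing D))
    exact regTrace_mem_of_mem S b hb (S.mul_mem (hsS i) (hsS j))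
  have hmul : ∀ i j k, |E.repr (1 ⊗ₜ (s i * s j)) k| ≤ d * d * (R * R) := by
    intro i j k
    have := abs_repr_mul_le E hE (hs i) (hs j) k
    rwa [Algebra.TensorProduct.tmul_mul_tmul, one_mul] at this
  have hmul3 : ∀ i j l k, |E.repr (1 ⊗ₜ (s i * s j * s l)) k| ≤
      d * d * (d * d * (R * R) * R) := by
    intro i j l k
    have := abs_repr_mul_le E hE (hmul i j) (hs l) k
    rwa [Algebra.TensorProduct.tmul_mul_tmul, one_mul] at this
  have htr : ∀ (x : D) (T : ℝ) (K : ℕ), (d : ℝ) * (d * d * T) ≤ K →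
      (∀ i, |E.repr (1 ⊗ₜ x) i| ≤ T) → |regTrace ℚ D x| ≤ K := by
    intro x T K hK hx
    have h1 := (abs_regTrace_le E hE hx).trans hK
    rw [regTrace_one_tmul] at h1
    have h2 : |((regTrace ℚ D x : ℚ) : ℝ)| ≤ ((K : ℚ) : ℝ) := by simpa using h1
    exact_mod_cast h2
  refine ⟨s, hsS, fun i j k => ?_⟩
  have h1 := abs_repr_le_of_regGram s hdet (K := ((K₁ + K₂ : ℕ) : ℚ))
    (fun i j => (htr _ _ K₁ hK₁ (hmul i j)).trans (by exact_mod_cast Nat.le_add_right _ _))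
    (s i * s j)
    (fun l => (htr _ _ K₂ hK₂ (hmul3 i j l)).trans (by exact_mod_cast Nat.le_add_left _ _)) k
  exact_mod_cast h1

/-- Orders in division algebras contain bases with bounded structure constants. -/
lemma exists_short_basis (N Δ : ℕ) :
    ∃ C : ℕ, ∀ (D : Type) [DivisionRing D] [Algebra ℚ D] [FiniteDimensional ℚ D],
      Module.finrank ℚ D ≤ N → ∀ S : Subring D, IsGoodOrder S Δ →
      ∃ s : Module.Basis (Fin (Module.finrank ℚ D)) ℚ D, (∀ k, s k ∈ S) ∧
        ∀ i j k, |s.repr (s i * s j) k| ≤ C := by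
  choose C hC using fun d : ℕ => exists_short_basis_of_finrank_eq (d + 1) Δ d.succ_pos
  refine ⟨∑ d ∈ Finset.range N, C d, ?_⟩
  intro D _ _ _ hN S hS
  have hpos : 0 < Module.finrank ℚ D := Module.finrank_pos
  obtain ⟨d, hd⟩ := Nat.exists_eq_succ_of_ne_zero hpos.ne'
  obtain ⟨s, hs, hs'⟩ := hC d D hd S hS
  rw [hd]
  refine ⟨s, hs, fun i j k => (hs' i j k).trans ?_⟩
  exact_mod_cast Finset.single_le_sum (f := C) (fun _ _ => Nat.zero_le _)
    (Finset.mem_range.2 (by omega : d < N))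

/-- Dirichlet's theorem on simultaneous approximation. -/
lemma exists_nat_abs_mul_sub_int_le (d Q : ℕ) (hQ : 0 < Q) (x : Fin d → ℚ) :
    ∃ t : ℕ, 0 < t ∧ t ≤ Q ^ d ∧ ∃ z : Fin d → ℤ, ∀ k, |(t : ℚ) * x k - z k| ≤ 1 / Q := by
  have hQ' : (0 : ℚ) < Q := by exact_mod_cast hQ
  have hlt : ∀ y : ℚ, ⌊(Q : ℚ) * Int.fract y⌋.toNat < Q := by
    intro y
    have h1 : (Q : ℚ) * Int.fract y < Q := by nlinarith [Int.fract_lt_one y]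
    have h2 : ⌊(Q : ℚ) * Int.fract y⌋ < (Q : ℤ) := Int.floor_lt.2 (by exact_mod_cast h1)
    omega
  let f : Fin (Q ^ d + 1) → (Fin d → Fin Q) := fun t k => ⟨_, hlt ((t : ℕ) * x k)⟩
  have hkey : ∀ a b : Fin (Q ^ d + 1), (a : ℕ) < b → f a = f b →
      ∃ t : ℕ, 0 < t ∧ t ≤ Q ^ d ∧ ∃ z : Fin d → ℤ, ∀ k, |(t : ℚ) * x k - z k| ≤ 1 / Q := by
    intro a b hab hf
    refine ⟨b - a, by omega, by omega,
      fun k => ⌊((b : ℕ) : ℚ) * x k⌋ - ⌊((a : ℕ) : ℚ) * x k⌋, fun k => ?_⟩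
    have h1 := congrArg Fin.val (congrFun hf k)
    have h2 : ⌊(Q : ℚ) * Int.fract (((a : ℕ) : ℚ) * x k)⌋ =
        ⌊(Q : ℚ) * Int.fract (((b : ℕ) : ℚ) * x k)⌋ := by
      have ha : 0 ≤ ⌊(Q : ℚ) * Int.fract (((a : ℕ) : ℚ) * x k)⌋ :=
        Int.floor_nonneg.2 (mul_nonneg hQ'.le (Int.fract_nonneg _))
      have hb : 0 ≤ ⌊(Q : ℚ) * Int.fract (((b : ℕ) : ℚ) * x k)⌋ :=
        Int.floor_nonneg.2 (mul_nonneg hQ'.le (Int.fract_nonneg _))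
      simp only [f] at h1
      omega
    have h3 := Int.abs_sub_lt_one_of_floor_eq_floor h2
    rw [← mul_sub, abs_mul, abs_of_pos hQ'] at h3
    have h4 : (((b : ℕ) - (a : ℕ) : ℕ) : ℚ) * x k -
        ((⌊((b : ℕ) : ℚ) * x k⌋ - ⌊((a : ℕ) : ℚ) * x k⌋ : ℤ) : ℚ) =
        -(Int.fract (((a : ℕ) : ℚ) * x k) - Int.fract (((b : ℕ) : ℚ) * x k)) := by
      rw [Nat.cast_sub hab.le, Int.fract, Int.fract]
      push_cast
      ring
    rw [h4, abs_neg, le_div_iff₀ hQ', mul_comm]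
    exact h3.le
  obtain ⟨a, b, hne, hf⟩ := Fintype.exists_ne_map_eq_of_card_lt f (by simp)
  rcases lt_or_gt_of_ne (fun h => hne (Fin.ext h) : (a : ℕ) ≠ b) with h | h
  · exact hkey a b h hf
  · exact hkey b a h hf.symm

/-- The additive group of integral combinations of a basis. -/
def intSpan {V ι : Type} [AddCommGroup V] [Module ℚ V] (s : Module.Basis ι ℚ V) : AddSubgroup V where
  carrier := {x | ∀ k, s.repr x k ∈ intSubring}
  add_mem' hx hy k := by
    rw [map_add]; exact add_mem (hx k) (hy k)
  zero_mem' k := by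
    rw [map_zero]; exact zero_mem _
  neg_mem' hx k := by
    rw [map_neg]; exact neg_mem (hx k)

lemma sum_intCast_smul_mem_intSpan {V ι : Type} [AddCommGroup V] [Module ℚ V] [Fintype ι]
    (s : Module.Basis ι ℚ V) (z : ι → ℤ) : ∑ k, (z k : ℚ) • s k ∈ intSpan s := fun k => by
  rw [Module.Basis.repr_sum_self]; exact intCast_mem_intSubring _

lemma intSpan_le {V ι : Type} [AddCommGroup V] [Module ℚ V] [Fintype ι]
    {s : Module.Basis ι ℚ V} {L : AddSubgroup V} (h : ∀ k, s k ∈ L) : intSpan s ≤ L := by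
  intro x hx
  choose z hz using fun i => mem_intSubring.1 (hx i)
  rw [← s.sum_repr x]
  refine sum_mem fun i _ => ?_
  rw [← hz, Int.cast_smul_eq_zsmul]
  exact zsmul_mem (h i) _

lemma exists_nsmul_mem_of_fg {V : Type} [AddCommGroup V] (L M : AddSubgroup V) (hL : L.FG)
    (hM : ∀ v : V, ∃ m : ℕ, 0 < m ∧ m • v ∈ M) : ∃ m : ℕ, 0 < m ∧ ∀ v ∈ L, m • v ∈ M := by
  obtain ⟨t, rfl⟩ := hL
  choose m hm hmM using hM
  refine ⟨∏ v ∈ t, m v, Finset.prod_pos fun v _ => hm v, fun v hv => ?_⟩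
  have : AddSubgroup.closure (t : Set V) ≤ M.comap (nsmulAddMonoidHom (∏ v ∈ t, m v)) := by
    rw [AddSubgroup.closure_le]
    intro w hw
    obtain ⟨c, hc⟩ := Finset.dvd_prod_of_mem m hw
    change (∏ v ∈ t, m v) • w ∈ M
    rw [hc, mul_comm, mul_smul]
    exact nsmul_mem (hmM w) c
  exact this hv

lemma abs_regNorm_le {D : Type} [Ring D] [Algebra ℚ D] {d : ℕ} (s : Module.Basis (Fin d) ℚ D)
    {C : ℕ} (hs : ∀ i j k, |s.repr (s i * s j) k| ≤ C) {ε : ℚ} {x : D}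
    (hx : ∀ k, |s.repr x k| ≤ ε) : |regNorm ℚ D x| ≤ d.factorial * (d * (ε * C)) ^ d := by
  rw [regNorm_apply, ← LinearMap.det_toMatrix s]
  have := Matrix.det_le (A := LinearMap.toMatrix s s (LinearMap.mul ℚ D x))
    (abv := IsAbsoluteValue.toAbsoluteValue (abs : ℚ → ℚ)) (x := d * (ε * C)) (fun i j => by
      rw [LinearMap.toMatrix_apply, LinearMap.mul_apply_apply]
      conv_lhs => rw [← s.sum_repr x, Finset.sum_mul]
      simp only [smul_mul_assoc, map_sum, map_smul, Finsupp.coe_finsetSum, Finset.sum_apply,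
        Finsupp.smul_apply, smul_eq_mul]
      refine (Finset.abs_sum_le_sum_abs _ _).trans ?_
      refine (Finset.sum_le_sum (g := fun _ : Fin d => ε * C) fun k _ => ?_).trans
        (by simp)
      rw [abs_mul]
      exact mul_le_mul (hx k) (hs k j i) (abs_nonneg _) ((abs_nonneg _).trans (hx k)))
  simpa using this

/-- A bound for the denominators in the Jordan–Zassenhaus theorem. -/
def jzDenom (N C : ℕ) : ℕ := ((N * C + 1) * (N.factorial + 1)) ^ N

lemma exists_nsmul_approx {D : Type} [Ring D] [Algebra ℚ D] {d N : ℕ}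
    (s : Module.Basis (Fin d) ℚ D) (hd : 0 < d) (hdN : d ≤ N)
    {C : ℕ} (hs : ∀ i j k, |s.repr (s i * s j) k| ≤ C) (q : D) :
    ∃ t : ℕ, 0 < t ∧ t ≤ jzDenom N C ∧ ∃ c ∈ intSpan s, |regNorm ℚ D (t • q - c)| < 1 := by
  set Q := (N * C + 1) * (N.factorial + 1) with hQ
  have hQ0 : 0 < Q := by positivity
  obtain ⟨t, ht0, ht, z, hz⟩ := exists_nat_abs_mul_sub_int_le d Q hQ0 (s.repr q)
  refine ⟨t, ht0, ht.trans (Nat.pow_le_pow_right hQ0 hdN), ∑ k, (z k : ℚ) • s k,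
    sum_intCast_smul_mem_intSpan s z, ?_⟩
  have h1 := abs_regNorm_le s hs (ε := 1 / Q) (x := t • q - ∑ k, (z k : ℚ) • s k) (fun k => by
    rw [map_sub, Finsupp.sub_apply, Module.Basis.repr_sum_self, ← Nat.cast_smul_eq_nsmul ℚ,
      map_smul, Finsupp.smul_apply, smul_eq_mul]
    exact hz k)
  refine h1.trans_lt ?_
  have hQq : (Q : ℚ) = (N * C + 1) * (N.factorial + 1) := by rw [hQ]; push_cast; ring
  have hdN' : (d : ℚ) ≤ N := by exact_mod_cast hdN
  have h2 : (d * (1 / Q * C) : ℚ) ≤ 1 / (N.factorial + 1) := by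
    rw [hQq, one_div_mul_eq_div, ← mul_div_assoc, div_le_div_iff₀ (by positivity) (by positivity)]
    have : (d * C : ℚ) ≤ N * C + 1 := by nlinarith [(Nat.cast_nonneg C : (0 : ℚ) ≤ C)]
    nlinarith [(Nat.cast_nonneg N.factorial : (0 : ℚ) ≤ N.factorial)]
  have h3 : (d * (1 / Q * C) : ℚ) ^ d ≤ 1 / (N.factorial + 1) := by
    refine (pow_le_of_le_one (by positivity) (h2.trans ?_) hd.ne').trans h2
    rw [div_le_one (by positivity)]
    linarith [(Nat.cast_nonneg N.factorial : (0 : ℚ) ≤ N.factorial)]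
  have h4 : (d.factorial : ℚ) ≤ N.factorial := by exact_mod_cast Nat.factorial_le hdN
  calc (d.factorial : ℚ) * (d * (1 / Q * C)) ^ d ≤ N.factorial * (1 / (N.factorial + 1)) := by gcongr
    _ < 1 := by rw [mul_one_div, div_lt_one (by positivity)]; linarith

lemma addSubgroup_fg_map {G H : Type*} [AddCommGroup G] [AddCommGroup H] {Y : AddSubgroup G}
    (hY : Y.FG) (g : G →+ H) : (Y.map g).FG := by
  classical
  obtain ⟨t, rfl⟩ := hY
  exact ⟨t.image g, by rw [Finset.coe_image, AddMonoidHom.map_closure]⟩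

lemma addSubgroup_fg_comap {G H : Type*} [AddCommGroup G] [AddCommGroup H] {Y : AddSubgroup H}
    (hY : Y.FG) (g : G →+ H) (hg : Function.Injective g) : (Y.comap g).FG := by
  have hno : IsNoetherian ℤ (AddSubgroup.toIntSubmodule Y) :=
    isNoetherian_of_fg_of_noetherian _ ((Submodule.fg_iff_addSubgroup_fg _).2 hY)
  have h1 : (Submodule.comap g.toIntLinearMap (AddSubgroup.toIntSubmodule Y)).FG := by
    refine Submodule.fg_of_fg_map_injective g.toIntLinearMap hg ?_
    have h2 : Submodule.map g.toIntLinearMap (Submodule.comap g.toIntLinearMap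
        (AddSubgroup.toIntSubmodule Y)) ≤ AddSubgroup.toIntSubmodule Y :=
      Submodule.map_comap_le _ _
    have := isNoetherian_of_le h2
    exact Module.Finite.iff_fg.1 inferInstance
  exact (Submodule.fg_iff_addSubgroup_fg _).1 h1

lemma addSubgroup_fg_of_le {G : Type*} [AddCommGroup G] {X Y : AddSubgroup G}
    (hY : Y.FG) (hXY : X ≤ Y) : X.FG := by
  have hno : IsNoetherian ℤ (AddSubgroup.toIntSubmodule Y) :=
    isNoetherian_of_fg_of_noetherian _ ((Submodule.fg_iff_addSubgroup_fg _).2 hY)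
  have h2 : AddSubgroup.toIntSubmodule X ≤ AddSubgroup.toIntSubmodule Y := hXY
  have := isNoetherian_of_le h2
  exact (Submodule.fg_iff_addSubgroup_fg (AddSubgroup.toIntSubmodule X)).1
    (Module.Finite.iff_fg.1 inferInstance)

section JordanZassenhaus

variable {D : Type} [DivisionRing D] [Algebra ℚ D] {d N : ℕ} (s : Module.Basis (Fin d) ℚ D)
  {C : ℕ} (S : Subring D)

lemma exists_generator_up_to_denom (hd : 0 < d) (hdN : d ≤ N)
    (hs : ∀ i j k, |s.repr (s i * s j) k| ≤ C)
    (hS : ∀ x : D, ∃ m : ℕ, 0 < m ∧ m • x ∈ S) (hN : ∀ x ∈ S, regNorm ℚ D x ∈ intSubring)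
    (hsS : ∀ k, s k ∈ S)
    (Z : AddSubgroup D) (hZ : Z.FG) (hZS : ∀ x ∈ S, ∀ z ∈ Z, x * z ∈ Z) (hZ0 : ∃ z ∈ Z, z ≠ 0) :
    ∃ z₀ ∈ Z, z₀ ≠ 0 ∧ ∀ z ∈ Z, ∃ c ∈ intSpan s, (jzDenom N C).factorial • z = c * z₀ := by
  have hfd : FiniteDimensional ℚ D := s.finiteDimensional_of_finite
  obtain ⟨m, hm0, hm⟩ := exists_nsmul_mem_of_fg Z S.toAddSubgroup hZ hS
  have hint : ∀ z ∈ Z, ∃ a : ℕ, |regNorm ℚ D (m • z)| = a := by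
    intro z hz
    obtain ⟨a, ha⟩ := mem_intSubring.1 (hN _ (hm z hz))
    exact ⟨a.natAbs, by rw [← ha, Nat.cast_natAbs, Int.cast_abs]⟩
  classical
  let p : ℕ → Prop := fun a => ∃ z ∈ Z, z ≠ 0 ∧ |regNorm ℚ D (m • z)| = a
  have hp : ∃ a, p a := by
    obtain ⟨z, hz, hz0⟩ := hZ0
    obtain ⟨a, ha⟩ := hint z hz
    exact ⟨a, z, hz, hz0, ha⟩
  obtain ⟨z₀, hz₀, hne, hval⟩ := Nat.find_spec hp
  have hmq : (m : ℚ) ≠ 0 := by exact_mod_cast hm0.ne'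
  have hmul : ∀ x : D, |regNorm ℚ D (m • x)| = |regNorm ℚ D (algebraMap ℚ D m)| * |regNorm ℚ D x| := by
    intro x
    rw [← abs_mul, ← map_mul, ← Nat.cast_smul_eq_nsmul ℚ, Algebra.smul_def]
  have hmin : ∀ z ∈ Z, |regNorm ℚ D z| < |regNorm ℚ D z₀| → z = 0 := by
    intro z hz hlt
    by_contra h0
    obtain ⟨a, ha⟩ := hint z hz
    have h1 : a < Nat.find hp := by
      have h2 : |regNorm ℚ D (m • z)| < |regNorm ℚ D (m • z₀)| := by
        rw [hmul, hmul]
        refine mul_lt_mul_of_pos_left hlt (abs_pos.2 (regNorm_ne_zero ?_))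
        have hchar : CharZero D := algebraRat.charZero D
        simpa using hm0.ne'
      rw [ha, hval] at h2
      exact_mod_cast h2
    exact Nat.find_min hp h1 ⟨z, hz, h0, ha⟩
  refine ⟨z₀, hz₀, hne, fun z hz => ?_⟩
  obtain ⟨t, ht0, htT, c, hc, hlt⟩ := exists_nsmul_approx s hd hdN hs (z * z₀⁻¹)
  have hcS : c ∈ S := intSpan_le (L := S.toAddSubgroup) hsS hc
  have h1 : t • z - c * z₀ = (t • (z * z₀⁻¹) - c) * z₀ := by
    rw [sub_mul, smul_mul_assoc, mul_assoc, inv_mul_cancel₀ hne, mul_one]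
  have h2 : t • z - c * z₀ = 0 := by
    refine hmin _ (sub_mem (nsmul_mem hz t) (hZS c hcS _ hz₀)) ?_
    rw [h1, map_mul, abs_mul]
    have := abs_pos.2 (regNorm_ne_zero (K := ℚ) hne)
    nlinarith
  obtain ⟨e, he⟩ := Nat.dvd_factorial ht0 htT
  refine ⟨e • c, nsmul_mem hc e, ?_⟩
  rw [he, mul_comm, mul_smul, sub_eq_zero.1 h2, smul_mul_assoc]

/-- An effective form of the Jordan–Zassenhaus theorem. -/
lemma exists_basis_up_to_denom (hd : 0 < d) (hdN : d ≤ N)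
    (hs : ∀ i j k, |s.repr (s i * s j) k| ≤ C)
    (hS : ∀ x : D, ∃ m : ℕ, 0 < m ∧ m • x ∈ S) (hN : ∀ x ∈ S, regNorm ℚ D x ∈ intSubring)
    (hsS : ∀ k, s k ∈ S) (n : ℕ) :
    ∀ (V : Type) [AddCommGroup V] [Module D V] [Module.Finite D V], Module.finrank D V = n →
      ∀ Y : AddSubgroup V, Y.FG → (∀ x ∈ S, ∀ y ∈ Y, x • y ∈ Y) →
      (∀ v : V, ∃ m : ℕ, 0 < m ∧ m • v ∈ Y) →
      ∃ ξ : Module.Basis (Fin n) D V, (∀ i, ξ i ∈ Y) ∧ ∀ y ∈ Y, ∃ c : Fin n → D,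
        (∀ i, c i ∈ intSpan s) ∧ ((jzDenom N C).factorial ^ n) • y = ∑ i, c i • ξ i := by
  have hchar : CharZero D := algebraRat.charZero D
  induction n with
  | zero =>
    intro V _ _ _ hfin Y _ _ _
    have hsub : Subsingleton V := Module.finrank_zero_iff.1 hfin
    refine ⟨Module.finBasisOfFinrankEq D V hfin, fun i => i.elim0, fun y _ => ⟨0, fun i => i.elim0,
      Subsingleton.elim _ _⟩⟩
  | succ n ih =>
    intro V _ _ _ hfin Y hY hYS hfull
    let f : V →ₗ[D] D := (Module.finBasisOfFinrankEq D V hfin).coord 0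
    have hf1 : f (Module.finBasisOfFinrankEq D V hfin 0) = 1 := by simp [f]
    have hZ0 : ∃ z ∈ Y.map f.toAddMonoidHom, z ≠ 0 := by
      obtain ⟨m, hm0, hm⟩ := hfull (Module.finBasisOfFinrankEq D V hfin 0)
      refine ⟨_, AddSubgroup.mem_map_of_mem _ hm, ?_⟩
      change f _ ≠ 0
      rw [map_nsmul, hf1, nsmul_one]
      exact_mod_cast hm0.ne'
    obtain ⟨z₀, ⟨ξ₀, hξ₀, rfl⟩, hne, hgen⟩ := exists_generator_up_to_denom s S hd hdN hs hS hN hsS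
      (Y.map f.toAddMonoidHom) (addSubgroup_fg_map hY _)
      (by
        rintro x hx _ ⟨y, hy, rfl⟩
        exact ⟨x • y, hYS x hx y hy, f.map_smul x y⟩) hZ0
    change f ξ₀ ≠ 0 at hne
    have hker : Module.finrank D (LinearMap.ker f) = n := by
      have h1 := LinearMap.finrank_range_add_finrank_ker f
      have h2 : LinearMap.range f = ⊤ := LinearMap.range_eq_top.2 fun x =>
        ⟨x • Module.finBasisOfFinrankEq D V hfin 0, by rw [map_smul, hf1, smul_eq_mul, mul_one]⟩
      rw [h2, finrank_top, Module.finrank_self, hfin] at h1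
      omega
    let Y' : AddSubgroup (LinearMap.ker f) := Y.comap (LinearMap.ker f).subtype.toAddMonoidHom
    have hY' : Y'.FG := addSubgroup_fg_comap hY _ Subtype.val_injective
    obtain ⟨ξ', hξ', hrep⟩ := ih (LinearMap.ker f) hker Y' hY'
      (fun x hx y hy => hYS x hx y hy)
      (fun v => hfull v)
    let ξ := Module.Basis.mkFinCons ξ₀ ξ'
      (fun c x hx h0 => by
        have h1 := congrArg f h0
        rw [map_add, map_smul, LinearMap.mem_ker.1 hx, add_zero, map_zero, smul_eq_mul] at h1
        exact (mul_eq_zero.1 h1).resolve_right hne)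
      (fun z => ⟨-(f z * (f ξ₀)⁻¹), by
        rw [LinearMap.mem_ker, map_add, map_smul, smul_eq_mul, neg_mul, mul_assoc,
          inv_mul_cancel₀ hne, mul_one, add_neg_cancel]⟩)
    have hξ : (ξ : Fin (n + 1) → V) = Fin.cons ξ₀ (fun i => (ξ' i : V)) :=
      Module.Basis.coe_mkFinCons _ _ _ _
    refine ⟨ξ, fun i => ?_, fun y hy => ?_⟩
    · rw [hξ]
      refine Fin.cases ?_ (fun i => ?_) i
      · exact hξ₀
      · exact hξ' i
    · obtain ⟨c, hc, hcz⟩ := hgen (f y) (AddSubgroup.mem_map_of_mem _ hy)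
      change _ = c * f ξ₀ at hcz
      have hcS : c ∈ S := intSpan_le (L := S.toAddSubgroup) hsS hc
      have hk : (jzDenom N C).factorial • y - c • ξ₀ ∈ LinearMap.ker f := by
        rw [LinearMap.mem_ker, map_sub, map_nsmul, map_smul, hcz, smul_eq_mul, sub_self]
      obtain ⟨c', hc', hsum⟩ := hrep ⟨_, hk⟩ (sub_mem (nsmul_mem hy _) (hYS c hcS _ hξ₀))
      have hsum' := congrArg Subtype.val hsum
      simp only [Submodule.coe_sum, Submodule.coe_smul] at hsum'
      refine ⟨Fin.cons (((jzDenom N C).factorial ^ n) • c) c', fun i => ?_, ?_⟩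
      · refine Fin.cases ?_ (fun i => ?_) i
        · exact nsmul_mem hc _
        · exact hc' i
      · rw [Fin.sum_univ_succ, hξ]
        simp only [Fin.cons_zero, Fin.cons_succ]
        rw [← hsum', pow_succ, mul_smul, smul_assoc]
        change _ = _ + (jzDenom N C).factorial ^ n • ((jzDenom N C).factorial • y - c • ξ₀)
        rw [smul_sub]
        abel

end JordanZassenhaus

lemma exists_nsmul_forall_mem {V ι : Type} [AddCommGroup V] [Finite ι] (M : AddSubgroup V)
    (hM : ∀ v : V, ∃ m : ℕ, 0 < m ∧ m • v ∈ M) (f : ι → V) :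
    ∃ m : ℕ, 0 < m ∧ ∀ i, m • f i ∈ M := by
  obtain ⟨m, hm, h⟩ := exists_nsmul_mem_of_fg (AddSubgroup.closure (Set.range f)) M
    ((AddSubgroup.fg_iff _).2 ⟨_, rfl, Set.finite_range f⟩) hM
  exact ⟨m, hm, fun i => h _ (AddSubgroup.subset_closure ⟨i, rfl⟩)⟩

section Blocks

variable {r : ℕ} {n : Fin r → ℕ} {D : Fin r → Type}
  [∀ k, DivisionRing (D k)]
  (Λ : Subring (∀ k, Matrix (Fin (n k)) (Fin (n k)) (D k))) (k : Fin r)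

/-- The rank one matrix `x ξ` in the `k`-th block of a product of matrix algebras. -/
def rankOne (x ξ : Fin (n k) → D k) : ∀ k, Matrix (Fin (n k)) (Fin (n k)) (D k) :=
  Pi.single k (Matrix.vecMulVec x ξ)

variable {k}

lemma rankOne_mul (x ξ : Fin (n k) → D k) (b : ∀ k, Matrix (Fin (n k)) (Fin (n k)) (D k)) :
    rankOne k x ξ * b = rankOne k x (Matrix.vecMul ξ (b k)) := by
  rw [rankOne, ← Pi.single_mul_left, Matrix.vecMulVec_mul, rankOne]

lemma rankOne_mul_rankOne (x ξ y η : Fin (n k) → D k) :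
    rankOne k x ξ * rankOne k y η = rankOne k x ((ξ ⬝ᵥ y) • η) := by
  rw [rankOne_mul, rankOne, rankOne, Pi.single_eq_same, Matrix.vecMul_vecMulVec, rankOne]

lemma rankOne_add (x ξ η : Fin (n k) → D k) :
    rankOne k x (ξ + η) = rankOne k x ξ + rankOne k x η := by
  rw [rankOne, Matrix.vecMulVec_add, Pi.single_add]; rfl

lemma rankOne_nsmul (x ξ : Fin (n k) → D k) (m : ℕ) :
    rankOne k x (m • ξ) = m • rankOne k x ξ := by
  rw [rankOne, rankOne, ← Pi.single_smul]
  congr 1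
  ext i j
  rw [Matrix.vecMulVec_apply, Matrix.smul_apply, Matrix.vecMulVec_apply, Pi.smul_apply, mul_smul_comm]

lemma nsmul_rankOne (x ξ : Fin (n k) → D k) (m : ℕ) :
    rankOne k (m • x) ξ = m • rankOne k x ξ := by
  rw [rankOne, rankOne, ← Pi.single_smul]
  congr 1
  ext i j
  rw [Matrix.vecMulVec_apply, Matrix.smul_apply, Matrix.vecMulVec_apply, Pi.smul_apply, smul_mul_assoc]

/-- Additive in the second variable. -/
def rankOneHom (x : Fin (n k) → D k) :
    (Fin (n k) → D k) →+ (∀ k, Matrix (Fin (n k)) (Fin (n k)) (D k)) where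
  toFun := rankOne k x
  map_zero' := by rw [rankOne, Matrix.vecMulVec_zero, Pi.single_zero]
  map_add' := rankOne_add x

variable (k)

/-- The columns all of whose products with unit row vectors lie in `Λ`. -/
def colSet : Set (Fin (n k) → D k) := {x | ∀ i, rankOne k x (Pi.single i 1) ∈ Λ}

/-- The rows whose products with the columns in `colSet Λ k` lie in `Λ`. -/
def rowLattice : AddSubgroup (Fin (n k) → D k) :=
  ⨅ x ∈ colSet Λ k, Λ.toAddSubgroup.comap (rankOneHom x)

variable {k}

lemma mem_rowLattice {ξ : Fin (n k) → D k} :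
    ξ ∈ rowLattice Λ k ↔ ∀ x ∈ colSet Λ k, rankOne k x ξ ∈ Λ := by
  simp only [rowLattice, AddSubgroup.mem_iInf, AddSubgroup.mem_comap]; rfl

lemma single_mem_rowLattice (i : Fin (n k)) : (Pi.single i 1 : Fin (n k) → D k) ∈ rowLattice Λ k :=
  (mem_rowLattice Λ).2 fun _ hx => hx i

lemma vecMul_mem_rowLattice {ξ : Fin (n k) → D k} (hξ : ξ ∈ rowLattice Λ k)
    {b : ∀ k, Matrix (Fin (n k)) (Fin (n k)) (D k)} (hb : b ∈ Λ) :
    Matrix.vecMul ξ (b k) ∈ rowLattice Λ k :=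
  (mem_rowLattice Λ).2 fun x hx => by
    rw [← rankOne_mul]; exact Λ.mul_mem ((mem_rowLattice Λ).1 hξ x hx) hb

variable (k) in
/-- The left multiplier ring of `rowLattice Λ k`. -/
def rowOrder : Subring (D k) where
  carrier := {s | ∀ ξ ∈ rowLattice Λ k, s • ξ ∈ rowLattice Λ k}
  mul_mem' ha hb ξ hξ := by rw [mul_smul]; exact ha _ (hb _ hξ)
  one_mem' ξ hξ := by rwa [one_smul]
  add_mem' ha hb ξ hξ := by rw [add_smul]; exact add_mem (ha _ hξ) (hb _ hξ)
  zero_mem' ξ hξ := by rw [zero_smul]; exact zero_mem _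
  neg_mem' ha ξ hξ := by rw [neg_smul]; exact neg_mem (ha _ hξ)

lemma dotProduct_mem_rowOrder {ξ x : Fin (n k) → D k} (hξ : ξ ∈ rowLattice Λ k)
    (hx : x ∈ colSet Λ k) : ξ ⬝ᵥ x ∈ rowOrder Λ k := fun η hη =>
  (mem_rowLattice Λ).2 fun y hy => by
    rw [← rankOne_mul_rankOne]
    exact Λ.mul_mem ((mem_rowLattice Λ).1 hξ y hy) ((mem_rowLattice Λ).1 hη x hx)

variable {Λ} {Δ : ℕ} [∀ k, Algebra ℚ (D k)]

lemma IsGoodOrder.exists_nsmul_mem_colSet (h : IsGoodOrder Λ Δ) (x : Fin (n k) → D k) :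
    ∃ m : ℕ, 0 < m ∧ m • x ∈ colSet Λ k := by
  obtain ⟨m, hm, hmem⟩ := exists_nsmul_forall_mem Λ.toAddSubgroup h.full
    (fun i => rankOne k x (Pi.single i 1))
  exact ⟨m, hm, fun i => by rw [nsmul_rankOne]; exact hmem i⟩

lemma IsGoodOrder.exists_nsmul_mem_rowLattice [∀ k, NeZero (n k)] (h : IsGoodOrder Λ Δ)
    (ξ : Fin (n k) → D k) : ∃ m : ℕ, 0 < m ∧ m • ξ ∈ rowLattice Λ k := by
  obtain ⟨m, hm, hmem⟩ := h.full (rankOne k (Pi.single 0 1) ξ)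
  refine ⟨m, hm, (mem_rowLattice Λ).2 fun x hx => ?_⟩
  have h1 := Λ.mul_mem (hx 0) hmem
  rwa [← rankOne_nsmul, rankOne_mul_rankOne, single_one_dotProduct, Pi.single_eq_same,
    one_smul] at h1

lemma IsGoodOrder.rowLattice_fg [∀ k, NeZero (n k)] (h : IsGoodOrder Λ Δ) :
    (rowLattice Λ k).FG := by
  have hchar : CharZero (D k) := algebraRat.charZero (D k)
  obtain ⟨m, hm, hmem⟩ := h.exists_nsmul_mem_colSet (k := k) (Pi.single 0 1)
  refine addSubgroup_fg_of_le (addSubgroup_fg_comap h.fg (rankOneHom (m • Pi.single 0 1)) ?_)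
    (fun ξ hξ => (mem_rowLattice Λ).1 hξ _ hmem)
  rw [injective_iff_map_eq_zero]
  intro ξ hξ
  funext j
  have h1 := congrFun (congrFun (congrFun hξ k) 0) j
  simp only [rankOneHom, AddMonoidHom.coe_mk, ZeroHom.coe_mk, rankOne, Pi.single_eq_same,
    Matrix.vecMulVec_apply, Pi.smul_apply, Pi.zero_apply, Matrix.zero_apply] at h1
  simpa [hm.ne'] using h1

lemma regTrace_rankOne_mul [∀ k, FiniteDimensional ℚ (D k)]
    (x ξ : Fin (n k) → D k) (b : ∀ k, Matrix (Fin (n k)) (Fin (n k)) (D k)) :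
    regTrace ℚ (∀ k, Matrix (Fin (n k)) (Fin (n k)) (D k)) (rankOne k x ξ * b) =
      n k * regTrace ℚ (D k) (Matrix.vecMul ξ (b k) ⬝ᵥ x) := by
  rw [rankOne_mul, regTrace_pi_matrix (fun k => Module.finBasis ℚ (D k)),
    Finset.sum_eq_single k]
  · rw [dotProduct, map_sum]
    congr 1
    refine Finset.sum_congr rfl fun i _ => ?_
    rw [rankOne, Pi.single_eq_same, Matrix.vecMulVec_apply, regTrace_mul_comm]
  · intro j _ hj
    simp [rankOne, Pi.single_eq_of_ne hj]
  · simp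

lemma IsGoodOrder.isGoodOrder_rowOrder [∀ k, NeZero (n k)] [∀ k, FiniteDimensional ℚ (D k)]
    (h : IsGoodOrder Λ Δ) : IsGoodOrder (rowOrder Λ k) Δ where
  pos := h.pos
  fg := by
    refine addSubgroup_fg_of_le (addSubgroup_fg_comap h.rowLattice_fg
      (AddMonoidHom.single (fun _ => D k) (0 : Fin (n k))) (Pi.single_injective (M := fun _ : Fin (n k) => D k) 0)) ?_
    intro s hs
    have h1 := hs _ (single_mem_rowLattice Λ 0)
    rw [← Pi.single_smul, smul_eq_mul, mul_one] at h1
    exact h1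
  full b := by
    obtain ⟨m, hm, hmem⟩ := exists_nsmul_mem_of_fg _ (rowLattice Λ k)
      (addSubgroup_fg_map h.rowLattice_fg (DistribSMul.toAddMonoidHom (Fin (n k) → D k) b))
      h.exists_nsmul_mem_rowLattice
    refine ⟨m, hm, fun ξ hξ => ?_⟩
    rw [smul_assoc]
    exact hmem _ ⟨ξ, hξ, rfl⟩
  dual d hd := by
    intro η hη
    refine (mem_rowLattice Λ).2 fun x hx => ?_
    rw [smul_assoc, rankOne_nsmul]
    refine h.dual _ fun b hb => ?_
    rw [regTrace_rankOne_mul, Matrix.smul_vecMul, smul_dotProduct, smul_eq_mul]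
    exact mul_mem (natCast_mem _ _)
      (hd _ (dotProduct_mem_rowOrder Λ (vecMul_mem_rowLattice Λ hη hb) hx))

end Blocks

lemma basis_transition_mul {D ι : Type} [DivisionRing D] [Fintype ι] [DecidableEq ι]
    (ξ : Module.Basis ι D (ι → D)) :
    (Matrix.of fun i j => ξ.repr (Pi.single i 1) j) * Matrix.of (fun i => ξ i) = 1 ∧
      Matrix.of (fun i => ξ i) * (Matrix.of fun i j => ξ.repr (Pi.single i 1) j) = 1 := by
  constructor
  · ext i k
    have h := congrFun (ξ.sum_repr (Pi.single i 1)) k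
    rw [Matrix.mul_apply, Matrix.one_apply]
    simpa [Finset.sum_apply, Pi.single_apply, eq_comm] using h
  · ext i k
    have h : ξ i = ∑ j, ξ i j • (Pi.single j 1 : ι → D) := by
      ext j
      simp [Finset.sum_apply, Pi.single_apply]
    have h1 := congrArg (fun v => ξ.repr v k) h
    simp only [map_sum, map_smul, Module.Basis.repr_self, Finsupp.coe_finsetSum,
      Finset.sum_apply, Finsupp.smul_apply, smul_eq_mul] at h1
    rw [Matrix.mul_apply, Matrix.one_apply]
    simp only [Matrix.of_apply]
    rw [← h1, Finsupp.single_apply]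

section Blocks

variable {r : ℕ} {n : Fin r → ℕ} {D : Fin r → Type}
  [∀ k, DivisionRing (D k)] [∀ k, Algebra ℚ (D k)] [∀ k, FiniteDimensional ℚ (D k)]
  [∀ k, NeZero (n k)]
  {Λ : Subring (∀ k, Matrix (Fin (n k)) (Fin (n k)) (D k))} {Δ : ℕ}

lemma IsGoodOrder.exists_block_matrix_units (h : IsGoodOrder Λ Δ) {N C : ℕ} (k : Fin r)
    (hN : Module.finrank ℚ (D k) ≤ N) (hn : n k ≤ N)
    (s : Module.Basis (Fin (Module.finrank ℚ (D k))) ℚ (D k)) (hs : ∀ l, s l ∈ rowOrder Λ k)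
    (hC : ∀ i j l, |s.repr (s i * s j) l| ≤ C) :
    ∃ g g' : Matrix (Fin (n k)) (Fin (n k)) (D k), g' * g = 1 ∧ g * g' = 1 ∧
      ∀ i j l, (Δ * (jzDenom N C).factorial ^ N) •
        Pi.single k (g' * Matrix.single j i (s l) * g) ∈ Λ := by
  have hS := h.isGoodOrder_rowOrder (k := k)
  obtain ⟨b, hb⟩ := exists_basis_of_lattice (rowOrder Λ k).toAddSubgroup hS.fg hS.full
  obtain ⟨ξ, hξ, hgen⟩ := exists_basis_up_to_denom (N := N) (C := C) s (rowOrder Λ k)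
    Module.finrank_pos hN hC hS.full (fun x hx => regNorm_mem_of_mem _ b hb hx) hs (n k)
    (Fin (n k) → D k) (Module.finrank_fin_fun _) (rowLattice Λ k) h.rowLattice_fg
    (fun x hx y hy => hx y hy) h.exists_nsmul_mem_rowLattice
  obtain ⟨h1, h2⟩ := basis_transition_mul ξ
  refine ⟨_, _, h1, h2, fun i j l => ?_⟩
  set g' : Matrix (Fin (n k)) (Fin (n k)) (D k) :=
    Matrix.of fun i j => ξ.repr (Pi.single i 1) j with hg'
  set g : Matrix (Fin (n k)) (Fin (n k)) (D k) := Matrix.of fun i => ξ i with hg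
  have hone : Pi.single k (g' * Matrix.single j i (s l) * g) =
      rankOne k (fun a => g' a j) (s l • ξ i) := by
    rw [rankOne]
    congr 1
    ext a c
    rw [Matrix.mul_assoc, Matrix.mul_apply, Matrix.vecMulVec_apply, Finset.sum_eq_single j]
    · rw [Matrix.single_mul_apply_same]; rfl
    · intro x _ hx
      rw [Matrix.single_mul_apply_of_ne _ _ _ _ _ hx, mul_zero]
    · simp
  rw [hone, mul_smul]
  refine h.dual _ fun x hx => ?_
  have hy : Matrix.vecMul (s l • ξ i) (x k) ∈ rowLattice Λ k :=
    vecMul_mem_rowLattice Λ (hs l _ (hξ i)) hx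
  obtain ⟨c, hc, hsum⟩ := hgen _ hy
  have hdot : ((jzDenom N C).factorial ^ n k) • (Matrix.vecMul (s l • ξ i) (x k) ⬝ᵥ fun a => g' a j)
      = c j := by
    rw [← smul_dotProduct, hsum, sum_dotProduct, Finset.sum_eq_single j]
    · rw [smul_dotProduct]
      have h3 := congrFun (congrFun h2 j) j
      rw [Matrix.mul_apply, Matrix.one_apply_eq] at h3
      change c j * ∑ a, ξ j a * g' a j = _
      change ∑ a, ξ j a * g' a j = 1 at h3
      rw [h3, mul_one]
    · intro a _ ha
      rw [smul_dotProduct]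
      have h3 := congrFun (congrFun h2 a) j
      rw [Matrix.mul_apply, Matrix.one_apply_ne ha] at h3
      change ∑ b, ξ a b * g' b j = 0 at h3
      change c a * ∑ b, ξ a b * g' b j = _
      rw [h3, mul_zero]
    · simp
  have hcj : c j ∈ rowOrder Λ k := intSpan_le (L := (rowOrder Λ k).toAddSubgroup) hs (hc j)
  obtain ⟨e, he⟩ := pow_dvd_pow (jzDenom N C).factorial hn
  rw [smul_mul_assoc, map_nsmul, regTrace_rankOne_mul, he, mul_comm _ e, mul_smul, ← nsmul_eq_mul,
    smul_comm _ (n k), ← map_nsmul, hdot]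
  exact nsmul_mem (nsmul_mem (regTrace_mem_of_mem _ b hb hcj) _) _

end Blocks

/-- Conjugation by an invertible element. -/
def conjAlgEquiv (K : Type) {A : Type} [CommSemiring K] [Semiring A] [Algebra K A] (g g' : A)
    (h : g' * g = 1) (h' : g * g' = 1) : A ≃ₐ[K] A where
  toFun x := g' * x * g
  invFun x := g * x * g'
  left_inv x := by
    calc g * (g' * x * g) * g' = (g * g') * x * (g * g') := by simp only [mul_assoc]
      _ = x := by rw [h', one_mul, mul_one]
  right_inv x := by
    calc g' * (g * x * g') * g = (g' * g) * x * (g' * g) := by simp only [mul_assoc]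
      _ = x := by rw [h, one_mul, mul_one]
  map_mul' x y := by
    calc g' * (x * y) * g = g' * x * 1 * y * g := by simp only [mul_assoc, one_mul]
      _ = g' * x * g * (g' * y * g) := by rw [← h']; simp only [mul_assoc]
  map_add' x y := by rw [mul_add, add_mul]
  commutes' a := by rw [← Algebra.commutes, mul_assoc, h, mul_one]

lemma conjAlgEquiv_apply {K A : Type} [CommSemiring K] [Semiring A] [Algebra K A] {g g' : A}
    (h : g' * g = 1) (h' : g * g' = 1) (x : A) : conjAlgEquiv K g g' h h' x = g' * x * g := rfl

lemma basis_map_repr_mul {K A A' ι : Type} [CommRing K] [Ring A] [Algebra K A] [Ring A']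
    [Algebra K A'] (e : A ≃ₐ[K] A') (b : Module.Basis ι K A) (i j k : ι) :
    (b.map e.toLinearEquiv).repr (b.map e.toLinearEquiv i * b.map e.toLinearEquiv j) k =
      b.repr (b i * b j) k := by
  have h : b.map e.toLinearEquiv i * b.map e.toLinearEquiv j = e.toLinearEquiv (b i * b j) := by
    simp
  rw [h, Module.Basis.map_repr, LinearEquiv.trans_apply, LinearEquiv.symm_apply_apply]

lemma unitsSMul_repr_mul {K A ι : Type} [Field K] [Ring A] [Algebra K A]
    (s : Module.Basis ι K A) (w : Kˣ) (i j k : ι) :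
    (s.unitsSMul fun _ => w).repr ((s.unitsSMul fun _ => w) i * (s.unitsSMul fun _ => w) j) k =
      w * s.repr (s i * s j) k := by
  simp only [Module.Basis.repr_unitsSMul, Module.Basis.unitsSMul_apply, Units.smul_def,
    smul_mul_assoc, mul_smul_comm, map_smul, Finsupp.smul_apply, smul_eq_mul]
  rw [Units.mul_inv_cancel_left]

lemma exists_bounded_basis_pi (N Δ : ℕ) :
    ∃ C : ℕ, ∀ (r : ℕ) (n : Fin r → ℕ) (D : Fin r → Type) [∀ k, DivisionRing (D k)]
      [∀ k, Algebra ℚ (D k)] [∀ k, FiniteDimensional ℚ (D k)] [∀ k, NeZero (n k)],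
      Module.finrank ℚ (∀ k, Matrix (Fin (n k)) (Fin (n k)) (D k)) ≤ N →
      ∀ Λ : Subring (∀ k, Matrix (Fin (n k)) (Fin (n k)) (D k)), IsGoodOrder Λ Δ →
      ∃ v : Module.Basis (Σ k, Fin (n k) × Fin (n k) × Fin (Module.finrank ℚ (D k))) ℚ
          (∀ k, Matrix (Fin (n k)) (Fin (n k)) (D k)),
        (∀ a, v a ∈ Λ) ∧ ∀ a b c, |v.repr (v a * v b) c| ≤ C := by
  obtain ⟨C, hC⟩ := exists_short_basis N Δ
  refine ⟨Δ * (jzDenom N C).factorial ^ N * C, ?_⟩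
  intro r n D _ _ _ _ hfin Λ h
  set m : ℕ := Δ * (jzDenom N C).factorial ^ N with hm
  have hm0 : (m : ℚ) ≠ 0 := by
    have := h.pos
    have := (jzDenom N C).factorial_pos
    positivity
  have hcard : ∀ k, n k * (n k * Module.finrank ℚ (D k)) ≤ N := by
    intro k
    refine le_trans ?_ hfin
    rw [Module.finrank_eq_card_basis (matBasis n fun k => Module.finBasis ℚ (D k)),
      Fintype.card_sigma]
    refine le_trans (le_of_eq ?_) (Finset.single_le_sum (fun _ _ => Nat.zero_le _)
      (Finset.mem_univ k))
    simp
  have hpos : ∀ k, 0 < n k := fun k => Nat.pos_of_ne_zero (NeZero.ne _)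
  have hposD : ∀ k, 0 < Module.finrank ℚ (D k) := fun k => Module.finrank_pos
  have hn : ∀ k, n k ≤ N := fun k =>
    (Nat.le_mul_of_pos_right _ (Nat.mul_pos (hpos k) (hposD k))).trans (hcard k)
  have hD : ∀ k, Module.finrank ℚ (D k) ≤ N := fun k =>
    ((Nat.le_mul_of_pos_left _ (hpos k)).trans (Nat.le_mul_of_pos_left _ (hpos k))).trans (hcard k)
  choose s hs hsC using fun k => hC (D k) (hD k) (rowOrder Λ k) h.isGoodOrder_rowOrder
  choose g g' hg hg' hmem using fun k => h.exists_block_matrix_units k (hD k) (hn k) (s k) (hs k)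
    (hsC k)
  have hG : (fun k => g' k) * (fun k => g k) = 1 := funext hg
  have hG' : (fun k => g k) * (fun k => g' k) = 1 := funext hg'
  let u := fun k => (s k).unitsSMul fun _ => Units.mk0 (m : ℚ) hm0
  refine ⟨(matBasis n u).map (conjAlgEquiv ℚ g g' hG hG').toLinearEquiv, fun a => ?_,
    fun a b c => ?_⟩
  · obtain ⟨k, j, i, l⟩ := a
    convert hmem k i j l using 1
    rw [Module.Basis.map_apply, AlgEquiv.toLinearEquiv_apply, conjAlgEquiv_apply, matBasis_apply]
    have h1 : u k l = m • s k l := by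
      simp only [u, Module.Basis.unitsSMul_apply, Units.smul_def, Units.val_mk0,
        Nat.cast_smul_eq_nsmul]
    rw [h1]
    funext k'
    by_cases hk : k' = k
    · subst hk
      simp only [Pi.mul_apply, Pi.smul_apply, Pi.single_eq_same]
      rw [← Matrix.smul_single, mul_smul_comm, smul_mul_assoc]
    · simp [Pi.single_eq_of_ne hk]
  · rw [basis_map_repr_mul]
    refine abs_matBasis_repr_le u (by positivity) (fun k i j l => ?_) a b c
    rw [unitsSMul_repr_mul, abs_mul, Units.val_mk0, Nat.abs_cast]
    push_cast [hm]
    gcongr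
    exact hsC k i j l

lemma IsGoodOrder.comap_symm {B B' : Type} [Ring B] [Algebra ℚ B] [Ring B'] [Algebra ℚ B']
    {Λ : Subring B} {Δ : ℕ} (h : IsGoodOrder Λ Δ) (e : B ≃ₐ[ℚ] B') :
    IsGoodOrder (Λ.comap (e.symm : B' →+* B)) Δ where
  pos := h.pos
  fg := addSubgroup_fg_comap h.fg (e.symm : B' →+* B).toAddMonoidHom e.symm.injective
  full b := by
    obtain ⟨m, hm, h1⟩ := h.full (e.symm b)
    exact ⟨m, hm, by simpa [Subring.mem_comap] using h1⟩
  dual b hb := by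
    have h1 := h.dual (e.symm b) fun x hx => by
      have h2 := hb (e x) (by simpa [Subring.mem_comap] using hx)
      rwa [← regTrace_algEquiv e, map_mul, AlgEquiv.apply_symm_apply]
    simpa [Subring.mem_comap] using h1

lemma exists_bounded_basis (N Δ : ℕ) :
    ∃ C : ℕ, ∀ (B : Type) [Ring B] [Algebra ℚ B] [IsSemisimpleRing B] [FiniteDimensional ℚ B],
      Module.finrank ℚ B ≤ N → ∀ Λ : Subring B, IsGoodOrder Λ Δ →
      ∃ v : Module.Basis (Fin (Module.finrank ℚ B)) ℚ B,
        (∀ a, v a ∈ Λ) ∧ ∀ a b c, |v.repr (v a * v b) c| ≤ C := by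
  obtain ⟨C, hC⟩ := exists_bounded_basis_pi N Δ
  refine ⟨C, ?_⟩
  intro B _ _ _ _ hN Λ h
  obtain ⟨r, D, n, _, _, _, _, ⟨e⟩⟩ :=
    IsSemisimpleRing.exists_algEquiv_pi_matrix_divisionRing_finite ℚ B
  obtain ⟨v, hv, hvC⟩ := hC r n D (by rwa [← e.toLinearEquiv.finrank_eq]) _ (h.comap_symm e)
  let w := v.map e.symm.toLinearEquiv
  let σ := Fintype.equivFinOfCardEq (Module.finrank_eq_card_basis w).symm
  refine ⟨w.reindex σ, fun a => ?_, fun a b c => ?_⟩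
  · rw [Module.Basis.reindex_apply]
    exact hv _
  · rw [Module.Basis.repr_reindex_apply, Module.Basis.reindex_apply, Module.Basis.reindex_apply,
      basis_map_repr_mul]
    exact hvC _ _ _

lemma factorial_nsmul_mem_intSpan {B ι : Type} [Ring B] [Algebra ℚ B] [Fintype ι] [DecidableEq ι]
    (b : Module.Basis ι ℚ B) (hG : ∀ i j, regGram ℚ b i j ∈ intSubring)
    (hnd : (regGram ℚ b).det ≠ 0) {P : ℕ} (hP : |(regGram ℚ b).det| ≤ P) (y : B)
    (hy : ∀ j, regTrace ℚ B (y * b j) ∈ intSubring) : P.factorial • y ∈ intSpan b := by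
  obtain ⟨z, hz⟩ := mem_intSubring.1 (Matrix.det_mem_subring intSubring hG)
  have hz0 : z ≠ 0 := by
    rintro rfl
    exact hnd (by rw [← hz, Int.cast_zero])
  have hzP : z.natAbs ≤ P := by
    rw [← hz] at hP
    have : ((z.natAbs : ℕ) : ℚ) ≤ P := by rwa [Nat.cast_natAbs, Int.cast_abs]
    exact_mod_cast this
  have hzy : z • y ∈ intSpan b := by
    intro k
    have h1 : Matrix.vecMul (b.repr y) (regGram ℚ b) = fun j => regTrace ℚ B (y * b j) := by
      funext j
      rw [← regTrace_sum_smul_mul, b.sum_repr]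
    have h2 : (z : ℚ) * b.repr y k =
        Matrix.vecMul (fun j => regTrace ℚ B (y * b j)) (regGram ℚ b).adjugate k := by
      rw [← h1, Matrix.vecMul_vecMul, Matrix.mul_adjugate, Matrix.vecMul_smul, Matrix.vecMul_one, hz]
      rfl
    rw [← Int.cast_smul_eq_zsmul ℚ, map_smul, Finsupp.smul_apply, smul_eq_mul, h2]
    exact sum_mem fun j _ => mul_mem (hy j) (Matrix.adjugate_mem_subring intSubring hG _ _)
  obtain ⟨e, he⟩ := Nat.dvd_factorial (Int.natAbs_pos.2 hz0) hzP
  have habs : z.natAbs • y ∈ intSpan b := by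
    rw [← natCast_zsmul]
    rcases Int.natAbs_eq z with h | h
    · rwa [← h]
    · rw [show ((z.natAbs : ℕ) : ℤ) = -z by omega, neg_smul]
      exact neg_mem hzy
  rw [he, mul_comm, mul_smul]
  exact nsmul_mem habs e

/-- Bound for the Gram determinant of a basis with structure constants at most `C`. -/
def gramBound (d C : ℕ) : ℕ := d.factorial * (d * (d * C) * C) ^ d

lemma abs_det_regGram_le_gramBound {B : Type} [Ring B] [Algebra ℚ B] {d : ℕ}
    (v : Module.Basis (Fin d) ℚ B) {C : ℕ} (hC : ∀ a b c, |v.repr (v a * v b) c| ≤ C) :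
    |(regGram ℚ v).det| ≤ gramBound d C := by
  have h1 : ∀ i, |regTrace ℚ B (v i)| ≤ (d * C : ℕ) := by
    intro i
    rw [regTrace_eq_sum_repr v]
    refine (Finset.abs_sum_le_sum_abs _ _).trans ((Finset.sum_le_sum fun j _ => hC i j j).trans ?_)
    simp
  have h2 : ∀ i j, |regGram ℚ v i j| ≤ (d * (d * C) * C : ℕ) := by
    intro i j
    rw [regGram, Matrix.of_apply, ← v.sum_repr (v i * v j), map_sum]
    refine (Finset.abs_sum_le_sum_abs _ _).trans ?_
    have : ∀ k ∈ Finset.univ, |regTrace ℚ B (v.repr (v i * v j) k • v k)| ≤ (C : ℚ) * (d * C : ℕ) := by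
      intro k _
      rw [map_smul, smul_eq_mul, abs_mul]
      exact mul_le_mul (hC i j k) (h1 k) (abs_nonneg _) (Nat.cast_nonneg _)
    refine (Finset.sum_le_sum this).trans (le_of_eq ?_)
    simp
    ring
  have h3 := Matrix.det_le (A := regGram ℚ v) (abv := AbsoluteValue.abs) h2
  rw [AbsoluteValue.abs_apply, Fintype.card_fin, nsmul_eq_mul] at h3
  rw [gramBound]
  exact_mod_cast h3

section Codes

variable {B B' : Type} [Ring B] [Algebra ℚ B] [Ring B'] [Algebra ℚ B'] {d M : ℕ}

/-- The classes modulo `M` of the numerators of elements of `Λ` with respect to `M⁻¹ v`. -/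
def residueSet (M : ℕ) (Λ : Subring B) (v : Module.Basis (Fin d) ℚ B) : Set (Fin d → ZMod M) :=
  {a | ∃ z : Fin d → ℤ, (∀ i, (z i : ZMod M) = a i) ∧ ∑ i, ((z i : ℚ) / M) • v i ∈ Λ}

lemma equiv_mem_of_residueSet_eq (hM : 0 < M) {Λ : Subring B} {Λ' : Subring B'}
    {v : Module.Basis (Fin d) ℚ B} {v' : Module.Basis (Fin d) ℚ B'} (hv' : ∀ i, v' i ∈ Λ')
    (hΛ : ∀ x ∈ Λ, M • x ∈ intSpan v) (hres : residueSet M Λ v = residueSet M Λ' v')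
    {x : B} (hx : x ∈ Λ) : v.equiv v' (Equiv.refl _) x ∈ Λ' := by
  have hM0 : (M : ℚ) ≠ 0 := by exact_mod_cast hM.ne'
  choose z hz using fun i => mem_intSubring.1 (hΛ x hx i)
  have hx' : x = ∑ i, ((z i : ℚ) / M) • v i := by
    conv_lhs => rw [← v.sum_repr x]
    refine Finset.sum_congr rfl fun i _ => ?_
    rw [hz, ← Nat.cast_smul_eq_nsmul ℚ, map_smul, Finsupp.smul_apply, smul_eq_mul,
      mul_div_cancel_left₀ _ hM0]
  have hmem : (fun i => (z i : ZMod M)) ∈ residueSet M Λ v := ⟨z, fun _ => rfl, hx' ▸ hx⟩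
  rw [hres] at hmem
  obtain ⟨z', hzz, hmem⟩ := hmem
  choose w hw using fun i => (ZMod.intCast_eq_intCast_iff_dvd_sub _ _ M).1 (hzz i)
  have hφ : v.equiv v' (Equiv.refl _) x =
      ∑ i, ((z' i : ℚ) / M) • v' i + ∑ i, (w i : ℚ) • v' i := by
    rw [hx', map_sum, ← Finset.sum_add_distrib]
    refine Finset.sum_congr rfl fun i _ => ?_
    rw [map_smul, Module.Basis.equiv_apply, Equiv.refl_apply, ← add_smul]
    congr 1
    have h1 : (z i : ℚ) = z' i + M * w i := by
      have := hw i
      have h2 : z i = z' i + M * w i := by omega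
      rw [h2]; push_cast; ring
    rw [h1]
    field_simp
  rw [hφ]
  refine Λ'.add_mem hmem (sum_mem fun i _ => ?_)
  rw [Int.cast_smul_eq_zsmul]
  exact zsmul_mem (hv' i) _

lemma nonempty_ringEquiv_of_residueSet_eq (hM : 0 < M) {Λ : Subring B} {Λ' : Subring B'}
    {v : Module.Basis (Fin d) ℚ B} {v' : Module.Basis (Fin d) ℚ B'} (hv : ∀ i, v i ∈ Λ)
    (hv' : ∀ i, v' i ∈ Λ') (hΛ : ∀ x ∈ Λ, M • x ∈ intSpan v)
    (hΛ' : ∀ x ∈ Λ', M • x ∈ intSpan v') (hres : residueSet M Λ v = residueSet M Λ' v')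
    (hmul : ∀ i j k, v.repr (v i * v j) k = v'.repr (v' i * v' j) k) :
    Nonempty (Λ ≃+* Λ') := by
  let φ : B ≃ₗ[ℚ] B' := v.equiv v' (Equiv.refl _)
  have hφv : ∀ i, φ (v i) = v' i := fun i => v.equiv_apply i v' (Equiv.refl _)
  have hbasis : ∀ i j, φ (v i * v j) = v' i * v' j := by
    intro i j
    rw [← v.sum_repr (v i * v j), ← v'.sum_repr (v' i * v' j), map_sum]
    exact Finset.sum_congr rfl fun k _ => by rw [map_smul, hφv, hmul]
  have hφ : ∀ x y, φ (x * y) = φ x * φ y := by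
    intro x y
    rw [← v.sum_repr x, ← v.sum_repr y]
    simp only [Finset.sum_mul_sum, map_sum, smul_mul_smul_comm, map_smul, hbasis, hφv]
  have hsymm : φ.symm = v'.equiv v (Equiv.refl _) := Module.Basis.equiv_symm _ _ _
  exact ⟨{
    toFun := fun x => ⟨φ x, equiv_mem_of_residueSet_eq hM hv' hΛ hres x.2⟩
    invFun := fun x => ⟨φ.symm x, by
      rw [hsymm]; exact equiv_mem_of_residueSet_eq hM hv hΛ' hres.symm x.2⟩
    left_inv := fun x => Subtype.ext (φ.symm_apply_apply x)
    right_inv := fun x => Subtype.ext (φ.apply_symm_apply x)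
    map_mul' := fun x y => Subtype.ext (hφ x y)
    map_add' := fun x y => Subtype.ext (map_add φ x.1 y.1) }⟩

end Codes

lemma exists_fin_representatives {κ : Type} [Finite κ] (P : ∀ (R : Type) [Ring R], κ → Prop)
    (h : ∀ (R : Type) [Ring R] (R' : Type) [Ring R'] (c : κ), P R c → P R' c →
      Nonempty (R ≃+* R')) :
    ∃ (k : ℕ) (R : Fin k → Type) (_ : ∀ i, Ring (R i)), ∀ (S : Type) [Ring S],
      (∃ c, P S c) → ∃ i, Nonempty (S ≃+* R i) := by
  have h1 : ∀ c, ∃ (R : Type) (_ : Ring R), ∀ (S : Type) [Ring S], P S c → Nonempty (S ≃+* R) := by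
    intro c
    by_cases hc : ∃ (R : Type) (_ : Ring R), P R c
    · obtain ⟨R, _, hR⟩ := hc
      exact ⟨R, inferInstance, fun S _ hS => h S R c hS hR⟩
    · exact ⟨ℤ, inferInstance, fun S _ hS => (hc ⟨S, inferInstance, hS⟩).elim⟩
  choose R hR hRS using h1
  let σ := Finite.equivFin κ
  refine ⟨Nat.card κ, fun i => R (σ.symm i), fun i => hR _, fun S _ ⟨c, hc⟩ => ⟨σ c, ?_⟩⟩
  have h2 := hRS (σ.symm (σ c)) S (by rwa [σ.symm_apply_apply])
  exact h2

lemma finite_good_orders (N Δ : ℕ) :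
    ∃ (k : ℕ) (R : Fin k → Type) (_ : ∀ i, Ring (R i)),
      ∀ (B : Type) [Ring B] [Algebra ℚ B] [IsSemisimpleRing B] [FiniteDimensional ℚ B],
        Module.finrank ℚ B ≤ N → (∀ x : B, (∀ y, regTrace ℚ B (x * y) = 0) → x = 0) →
      ∀ Λ : Subring B, IsGoodOrder Λ Δ → ∃ i, Nonempty (Λ ≃+* R i) := by
  obtain ⟨C, hC⟩ := exists_bounded_basis N Δ
  let M : ℕ → ℕ := fun d => (gramBound d C).factorial
  have hM : ∀ d, 0 < M d := fun d => Nat.factorial_pos _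
  have hMne : ∀ d, NeZero (M d) := fun d => ⟨(hM d).ne'⟩
  let κ := Σ d : Fin (N + 1), (Fin d → Fin d → Fin d →
    Set.Icc (-((M d * C : ℕ) : ℤ)) (M d * C : ℕ)) × Set (Fin d → ZMod (M d))
  let P : ∀ (R : Type) [Ring R], κ → Prop := fun R _ c =>
    ∃ (B : Type) (_ : Ring B) (_ : Algebra ℚ B) (Λ : Subring B) (v : Module.Basis (Fin c.1) ℚ B),
      (∀ i, v i ∈ Λ) ∧ (∀ x ∈ Λ, M c.1 • x ∈ intSpan v) ∧
      (∀ i j k, (M c.1 : ℚ) * v.repr (v i * v j) k = ((c.2.1 i j k : ℤ) : ℚ)) ∧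
      residueSet (M c.1) Λ v = c.2.2 ∧ Nonempty (R ≃+* Λ)
  obtain ⟨k, R, hR, hrep⟩ := exists_fin_representatives P (by
    rintro R _ R' _ c ⟨B, _, _, Λ, v, hv, hΛ, hmul, hres, ⟨e⟩⟩
      ⟨B', _, _, Λ', v', hv', hΛ', hmul', hres', ⟨e'⟩⟩
    obtain ⟨f⟩ := nonempty_ringEquiv_of_residueSet_eq (hM c.1) hv hv' hΛ hΛ' (hres.trans hres'.symm)
      (fun i j k => by
        have h0 : (M c.1 : ℚ) ≠ 0 := by exact_mod_cast (hM c.1).ne'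
        exact mul_left_cancel₀ h0 ((hmul i j k).trans (hmul' i j k).symm))
    exact ⟨(e.trans f).trans e'.symm⟩)
  refine ⟨k, R, hR, ?_⟩
  intro B _ _ _ _ hN hnd Λ h
  obtain ⟨v, hv, hvC⟩ := hC B hN Λ h
  obtain ⟨b, hb⟩ := exists_basis_of_lattice Λ.toAddSubgroup h.fg h.full
  have htr : ∀ x ∈ Λ, regTrace ℚ B x ∈ intSubring := fun x hx => regTrace_mem_of_mem Λ b hb hx
  have hspan : ∀ x ∈ Λ, M (Module.finrank ℚ B) • x ∈ intSpan v := fun x hx =>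
    factorial_nsmul_mem_intSpan v (fun i j => htr _ (Λ.mul_mem (hv i) (hv j)))
      ((regGram_det_ne_zero_iff v).2 hnd) (abs_det_regGram_le_gramBound v hvC) x
      (fun j => htr _ (Λ.mul_mem hx (hv j)))
  have hconst : ∀ i j k, ∃ z : Set.Icc (-((M (Module.finrank ℚ B) * C : ℕ) : ℤ))
      (M (Module.finrank ℚ B) * C : ℕ),
      (M (Module.finrank ℚ B) : ℚ) * v.repr (v i * v j) k = ((z : ℤ) : ℚ) := by
    intro i j k
    have h1 := hspan _ (Λ.mul_mem (hv i) (hv j)) k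
    rw [← Nat.cast_smul_eq_nsmul ℚ, map_smul, Finsupp.smul_apply, smul_eq_mul] at h1
    obtain ⟨z, hz⟩ := mem_intSubring.1 h1
    refine ⟨⟨z, abs_le.1 ?_⟩, hz.symm⟩
    have h2 : |(z : ℚ)| ≤ (M (Module.finrank ℚ B) * C : ℕ) := by
      rw [hz, abs_mul, Nat.abs_cast, Nat.cast_mul]
      exact mul_le_mul_of_nonneg_left (hvC i j k) (Nat.cast_nonneg _)
    exact_mod_cast h2
  choose z hz using hconst
  exact hrep Λ ⟨⟨⟨Module.finrank ℚ B, Nat.lt_succ_of_le hN⟩, z, residueSet _ Λ v⟩, B, inferInstance,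
    inferInstance, Λ, v, hv, hspan, hz, rfl, ⟨RingEquiv.refl _⟩⟩

section ReducedTrace

variable {K L B ι : Type} [Field K] [Field L] [Algebra K L] [Ring B] [Algebra K B]
  [Fintype ι] [DecidableEq ι] {m : ℕ} {n : Fin m → ℕ}

lemma regTrace_pi_matrix_field (x : ∀ p, Matrix (Fin (n p)) (Fin (n p)) L) :
    regTrace L (∀ p, Matrix (Fin (n p)) (Fin (n p)) L) x = ∑ p, (n p : L) * (x p).trace := by
  have h : ∀ y : L, regTrace L L y = y := fun y => by
    simpa using regTrace_algebraMap (K := L) (A := L) y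
  rw [regTrace_pi_matrix (fun _ => Module.Basis.singleton Unit L)]
  simp only [h, Matrix.trace, Matrix.diag_apply]

variable (L n) in
/-- The central element comparing the regular and the reduced trace. -/
def degreeElement : ∀ p, Matrix (Fin (n p)) (Fin (n p)) L := fun p => (n p : L) • 1

lemma regTrace_eq_trace_degreeElement_mul (x : ∀ p, Matrix (Fin (n p)) (Fin (n p)) L) :
    regTrace L (∀ p, Matrix (Fin (n p)) (Fin (n p)) L) x =
      ∑ p, ((degreeElement L n * x) p).trace := by
  rw [regTrace_pi_matrix_field]
  refine Finset.sum_congr rfl fun p _ => ?_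
  rw [Pi.mul_apply, degreeElement, smul_mul_assoc, one_mul, Matrix.trace_smul, smul_eq_mul]

variable (n) in
/-- The index set of the matrix units. -/
abbrev MatrixUnitIndex : Type := Σ p, Fin (n p) × Fin (n p) × Unit

lemma det_mul_degreeElement :
    LinearMap.det (LinearMap.mul L _ (degreeElement L n)) =
      ((∏ a : MatrixUnitIndex n, n a.1 : ℕ) : L) := by
  classical
  let E := matBasis (K := L) n (fun _ => Module.Basis.singleton Unit L)
  rw [← LinearMap.det_toMatrix E]
  have h : LinearMap.toMatrix E E (LinearMap.mul L _ (degreeElement L n)) =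
      Matrix.diagonal fun a => (n a.1 : L) := by
    ext a c
    have hc : degreeElement L n * E c = (n c.1 : L) • E c := by
      obtain ⟨p, i, j, l⟩ := c
      funext q
      rw [Pi.mul_apply, degreeElement, smul_mul_assoc, one_mul, Pi.smul_apply, matBasis_apply]
      by_cases hq : q = p
      · subst hq; rfl
      · rw [Pi.single_eq_of_ne hq, smul_zero, smul_zero]
    rw [LinearMap.toMatrix_apply, LinearMap.mul_apply', hc, map_smul, Module.Basis.repr_self,
      Finsupp.smul_apply, Matrix.diagonal_apply, Finsupp.single_apply]
    by_cases hac : a = c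
    · subst hac; simp
    · simp [hac, Ne.symm hac]
  rw [h, Matrix.det_diagonal, Nat.cast_prod]

lemma regTrace_eq_of_split [FiniteDimensional K B]
    (e : (L ⊗[K] B) ≃ₐ[L] (∀ p, Matrix (Fin (n p)) (Fin (n p)) L)) (x : B) :
    regTrace L (∀ p, Matrix (Fin (n p)) (Fin (n p)) L) (e (1 ⊗ₜ x)) =
      algebraMap K L (regTrace K B x) := by
  rw [regTrace_algEquiv, regTrace_one_tmul]

lemma det_regGram_eq [FiniteDimensional K B] (t : B →ₗ[K] K)
    (e : (L ⊗[K] B) ≃ₐ[L] (∀ p, Matrix (Fin (n p)) (Fin (n p)) L))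
    (ht : ∀ x : B, algebraMap K L (t x) = ∑ p, (e (1 ⊗ₜ x) p).trace)
    (b : Module.Basis ι K B) :
    (regGram K b).det = ((∏ a : MatrixUnitIndex n, n a.1 : ℕ) : K) *
      (Matrix.of fun i j => t (b i * b j)).det := by
  let c : Module.Basis ι L (∀ p, Matrix (Fin (n p)) (Fin (n p)) L) :=
    (b.baseChange L).map e.toLinearEquiv
  have hc : ∀ i, c i = e (1 ⊗ₜ b i) := fun i => by simp [c]
  have hcc : ∀ i j, c i * c j = e (1 ⊗ₜ (b i * b j)) := fun i j => by
    rw [hc, hc, ← map_mul, Algebra.TensorProduct.tmul_mul_tmul, one_mul]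
  have hG : (regGram K b).map (algebraMap K L) =
      (LinearMap.toMatrix c c (LinearMap.mul L _ (degreeElement L n))).transpose *
        (Matrix.of fun i j => t (b i * b j)).map (algebraMap K L) := by
    ext i j
    have h1 : degreeElement L n * c i = ∑ k, c.repr (degreeElement L n * c i) k • c k :=
      (c.sum_repr _).symm
    rw [Matrix.map_apply, regGram, Matrix.of_apply, ← regTrace_eq_of_split e, ← hcc,
      regTrace_eq_trace_degreeElement_mul, ← mul_assoc, h1, Matrix.mul_apply]
    simp only [Matrix.transpose_apply, LinearMap.toMatrix_apply, LinearMap.mul_apply',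
      Matrix.map_apply, Matrix.of_apply, ht, ← hcc, Finset.sum_mul, smul_mul_assoc,
      Finset.sum_apply, Pi.smul_apply, Matrix.trace_sum, Matrix.trace_smul, Finset.mul_sum,
      smul_eq_mul]
    rw [Finset.sum_comm]
  apply (algebraMap K L).injective
  have h2 := congrArg Matrix.det hG
  rw [Matrix.det_mul, Matrix.det_transpose, LinearMap.det_toMatrix, det_mul_degreeElement,
    ← RingHom.mapMatrix_apply, ← RingHom.mapMatrix_apply, ← RingHom.map_det,
    ← RingHom.map_det] at h2
  rw [h2, map_mul, map_natCast]

lemma regTrace_nondegenerate_of_split [CharZero L] [FiniteDimensional K B]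
    (e : (L ⊗[K] B) ≃ₐ[L] (∀ p, Matrix (Fin (n p)) (Fin (n p)) L)) (x : B)
    (hx : ∀ y, regTrace K B (x * y) = 0) : x = 0 := by
  classical
  let b := Module.finBasis K B
  let c : Module.Basis _ L (∀ p, Matrix (Fin (n p)) (Fin (n p)) L) :=
    (b.baseChange L).map e.toLinearEquiv
  refine (regGram_det_ne_zero_iff b).1 (fun h0 => ?_) x hx
  refine (regGram_det_ne_zero_iff c).2 (fun y hy => ?_) ?_
  · funext p
    ext i j
    have hn : (n p : L) ≠ 0 := by
      have := i.pos
      exact_mod_cast this.ne'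
    have h1 := hy (Pi.single p (Matrix.single j i 1))
    rw [regTrace_mul_comm, regTrace_single_mul (fun _ => Module.Basis.singleton Unit L), one_mul] at h1
    have h2 : regTrace L L (y p i j) = y p i j := by
      simpa using regTrace_algebraMap (K := L) (A := L) (y p i j)
    rw [h2] at h1
    exact (mul_eq_zero.1 h1).resolve_left hn
  · have hG : regGram L c = (regGram K b).map (algebraMap K L) := by
      ext i j
      rw [Matrix.map_apply, regGram, regGram, Matrix.of_apply, Matrix.of_apply,
        ← regTrace_eq_of_split e]
      congr 1
      simp only [c, Module.Basis.map_apply, Module.Basis.baseChange_apply,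
        AlgEquiv.toLinearEquiv_apply]
      rw [← map_mul, Algebra.TensorProduct.tmul_mul_tmul, one_mul]
    rw [hG, ← RingHom.mapMatrix_apply, ← RingHom.map_det, h0, map_zero]

lemma prod_matrixUnitIndex_le [FiniteDimensional K B]
    (e : (L ⊗[K] B) ≃ₐ[L] (∀ p, Matrix (Fin (n p)) (Fin (n p)) L)) {N : ℕ}
    (hN : Module.finrank K B ≤ N) : ∏ a : MatrixUnitIndex n, n a.1 ≤ N ^ N := by
  have hcard : Fintype.card (MatrixUnitIndex n) = Module.finrank K B := by
    rw [← Module.finrank_eq_card_basis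
      (matBasis (K := L) n (fun _ => Module.Basis.singleton Unit L)),
      ← e.toLinearEquiv.finrank_eq, Module.finrank_baseChange]
  have hle : ∀ a : MatrixUnitIndex n, n a.1 ≤ N := by
    rintro ⟨p, i, -⟩
    have h1 : n p * n p ≤ Fintype.card (MatrixUnitIndex n) := by
      rw [Fintype.card_sigma]
      refine le_trans (le_of_eq ?_) (Finset.single_le_sum (fun _ _ => Nat.zero_le _)
        (Finset.mem_univ p))
      simp
    exact (Nat.le_mul_of_pos_left _ i.pos).trans (h1.trans (hcard.le.trans hN))
  have h := Finset.prod_le_pow_card Finset.univ (fun a : MatrixUnitIndex n => n a.1) N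
    (fun a _ => hle a)
  rw [Finset.card_univ, hcard] at h
  rcases Nat.eq_zero_or_pos N with rfl | hpos
  · rwa [Nat.le_zero.1 hN] at h
  · exact h.trans (Nat.pow_le_pow_right hpos hN)

end ReducedTrace

lemma isGoodOrder_of_basis {B ι : Type} [Ring B] [Algebra ℚ B] [Fintype ι] [DecidableEq ι]
    (Λ : Subring B) (b : Module.Basis ι ℚ B)
    (hb : ∀ x, x ∈ Λ ↔ ∀ i, b.repr x i ∈ intSubring)
    (hnd : (regGram ℚ b).det ≠ 0) {P : ℕ} (hP : |(regGram ℚ b).det| ≤ P) :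
    IsGoodOrder Λ P.factorial where
  pos := P.factorial_pos
  fg := by
    classical
    refine ⟨Finset.univ.image b, le_antisymm ((AddSubgroup.closure_le _).2 ?_) fun x hx => ?_⟩
    · intro y hy
      obtain ⟨i, -, rfl⟩ := Finset.mem_image.1 (Finset.mem_coe.1 hy)
      refine (hb _).2 fun j => ?_
      rw [Module.Basis.repr_self, Finsupp.single_apply]
      split_ifs
      exacts [intSubring.one_mem, intSubring.zero_mem]
    · exact intSpan_le (s := b) (fun k => AddSubgroup.subset_closure (by simp)) ((hb x).1 hx)
  full x := by
    refine ⟨∏ i, (b.repr x i).den, Finset.prod_pos fun i _ => (b.repr x i).den_pos,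
      (hb _).2 fun i => ?_⟩
    rw [← Nat.cast_smul_eq_nsmul ℚ, map_smul, Finsupp.smul_apply, smul_eq_mul,
      ← Finset.mul_prod_erase _ _ (Finset.mem_univ i), Nat.cast_mul, mul_right_comm, mul_comm,
      Rat.den_mul_eq_num]
    exact mul_mem (natCast_mem _ _) (intCast_mem_intSubring _)
  dual y hy := by
    have hmem : ∀ i, b i ∈ Λ := fun i => (hb _).2 fun j => by
      rw [Module.Basis.repr_self, Finsupp.single_apply]
      split_ifs
      exacts [intSubring.one_mem, intSubring.zero_mem]
    exact (hb _).2 (factorial_nsmul_mem_intSpan b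
      (fun i j => regTrace_mem_of_mem Λ b hb (Λ.mul_mem (hmem i) (hmem j))) hnd hP y
      (fun j => hy _ (hmem j)))

lemma exists_basis_extending {B ι : Type} [Ring B] [Algebra ℚ B] [Fintype ι] (Λ : Subring B)
    (b₀ : Module.Basis ι ℤ Λ) (hspan : Submodule.span ℚ (Λ : Set B) = ⊤) :
    ∃ b : Module.Basis ι ℚ B, (∀ i, b i = b₀ i) ∧
      ∀ x, x ∈ Λ ↔ ∀ i, b.repr x i ∈ intSubring := by
  have hli : LinearIndependent ℚ fun i => (b₀ i : B) := by
    rw [← LinearIndependent.iff_fractionRing (R := ℤ)]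
    exact b₀.linearIndependent.map' Λ.subtype.toAddMonoidHom.toIntLinearMap
      (LinearMap.ker_eq_bot.2 Subtype.val_injective)
  have hsum : ∀ x (hx : x ∈ Λ), x = ∑ i, ((b₀.repr ⟨x, hx⟩ i : ℤ) : ℚ) • (b₀ i : B) := by
    intro x hx
    have := congrArg Subtype.val (b₀.sum_repr ⟨x, hx⟩)
    rw [AddSubmonoidClass.coe_finsetSum] at this
    refine this.symm.trans ?_
    refine Finset.sum_congr rfl fun i _ => ?_
    rw [Int.cast_smul_eq_zsmul]; rfl
  have hsp : ⊤ ≤ Submodule.span ℚ (Set.range fun i => (b₀ i : B)) := by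
    rw [← hspan, Submodule.span_le]
    intro x hx
    rw [hsum x hx]
    exact sum_mem fun i _ => Submodule.smul_mem _ _ (Submodule.subset_span ⟨i, rfl⟩)
  let b := Module.Basis.mk hli hsp
  have hbi : ∀ i, b i = b₀ i := fun i => Module.Basis.mk_apply hli hsp i
  refine ⟨b, hbi, fun x => ⟨fun hx i => ?_, fun hx => ?_⟩⟩
  · have h1 := hsum x hx
    simp only [← hbi] at h1
    rw [h1, Module.Basis.repr_sum_self]
    exact intCast_mem_intSubring _
  · exact intSpan_le (L := Λ.toAddSubgroup) (s := b) (fun k => by rw [hbi]; exact (b₀ k).2) hx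

/-- given a bound `N` on the dimension of a finite-dimensional semisimple
`ℚ`-algebra `B` and on the absolute value of the discriminant (for the reduced trace form)
of orders in `B`, there are only finitely many isomorphism classes of pairs `(B, Λ)` with `Λ`
an order in `B` of discriminant bounded by `N` (isomorphism of pairs meaning ring isomorphism
of the orders). -/
theorem stmt10 (N : ℕ) :
    ∃ (k : ℕ) (R : Fin k → Type) (_ : ∀ i, Ring (R i)),
      ∀ (B : Type) [Ring B] [Algebra ℚ B] [IsSemisimpleRing B] [FiniteDimensional ℚ B],
        Module.finrank ℚ B ≤ N →
      ∀ t : B →ₗ[ℚ] ℚ, IsReducedTrace ℚ B t →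
      ∀ (Λ : Subring B) [Module.Free ℤ Λ] [Module.Finite ℤ Λ],
        Submodule.span ℚ (Λ : Set B) = ⊤ →
      ∀ T : Λ → Λ → ℤ, (∀ x y : Λ, ((T x y : ℤ) : ℚ) = t ((x : B) * (y : B))) →
        |gramDet ℤ ℤ T| ≤ (N : ℤ) →
      ∃ i, Nonempty (Λ ≃+* R i) := by
  obtain ⟨k, R, hR, hrep⟩ := finite_good_orders N (N ^ N * N).factorial
  refine ⟨k, R, hR, ?_⟩
  intro B _ _ _ _ hN t ⟨m, n, e, ht⟩ Λ _ _ hspan T hT hdisc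
  classical
  obtain ⟨b, hb₀, hb⟩ := exists_basis_extending Λ (Module.Free.chooseBasis ℤ Λ) hspan
  have hnd := regTrace_nondegenerate_of_split e
  have hdet : |(Matrix.of fun i j => t (b i * b j)).det| ≤ (N : ℚ) := by
    have h1 : (Matrix.of fun i j => t (b i * b j)) =
        (Matrix.of fun i j => T (Module.Free.chooseBasis ℤ Λ i)
          (Module.Free.chooseBasis ℤ Λ j)).map (Int.castRingHom ℚ) := by
      ext i j
      rw [Matrix.map_apply, Matrix.of_apply, Matrix.of_apply, hb₀, hb₀, eq_intCast, hT]
    rw [h1, ← RingHom.mapMatrix_apply, ← RingHom.map_det, eq_intCast]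
    have h2 : |(Matrix.of fun i j => T (Module.Free.chooseBasis ℤ Λ i)
        (Module.Free.chooseBasis ℤ Λ j)).det| ≤ (N : ℤ) := by
      convert hdisc using 2
      rw [gramDet]
    exact_mod_cast h2
  refine hrep B hN hnd Λ (isGoodOrder_of_basis Λ b hb ((regGram_det_ne_zero_iff b).2 hnd) ?_)
  rw [det_regGram_eq t e ht b, abs_mul, Nat.abs_cast, Nat.cast_mul]
  exact mul_le_mul (by exact_mod_cast prod_matrixUnitIndex_le e hN) hdet (abs_nonneg _)
    (Nat.cast_nonneg _)
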